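/- arXiv:2203.06329 — 3 statements merged into one kernel-verified Lean document; each statement's English description precedes it below -/
import Mathlib

section
/- Fix c > 1. Then lim_{ν→∞} (θ(ν, cν) − ν·√(c² − 1) + ν·arccos(1/c) + π/4) = 0. -/
open Real MeasureTheory Set Filter intervalIntegral

/-- Integral representation of the modified Bessel function `K₀`. -/
noncomputable def K0 (x : ℝ) : ℝ := ∫ t in Ioi (0:ℝ), Real.exp (-x * Real.cosh t)

/-- Bessel modulus squared, via Nicholson's formula. -/
noncomputable def M2 (ν z : ℝ) : ℝ :=
  (8 / π ^ 2) * ∫ t in Ioi (0:ℝ), K0 (2 * z * Real.sinh t) * Real.cosh (2 * ν * t)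

/-- The Bessel phase. -/
noncomputable def phase (ν z : ℝ) : ℝ :=
  -(π / 2) + (2 / π) * ∫ u in (0:ℝ)..z, 1 / (u * M2 ν u)

/-- Moments of the integrand of `K0`: the functions `∫₀^∞ cosh^n t · exp (-x cosh t) dt`. -/
noncomputable def coshMoment (n : ℕ) (x : ℝ) : ℝ :=
  ∫ t in Ioi (0:ℝ), Real.cosh t ^ n * Real.exp (-x * Real.cosh t)

lemma coshMoment_zero (x : ℝ) : coshMoment 0 x = K0 x := by
  simp [coshMoment, K0]

lemma one_add_sq_half_le_cosh (t : ℝ) : 1 + t ^ 2 / 2 ≤ Real.cosh t := by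
  have h : ∀ s : ℝ, 0 ≤ s → 1 + s ^ 2 / 2 ≤ Real.cosh s := by
    intro s hs
    have h1 : Real.cosh s = 1 + 2 * Real.sinh (s / 2) ^ 2 := by
      have := Real.cosh_two_mul (s / 2)
      rw [show 2 * (s / 2) = s by ring] at this
      rw [this, Real.cosh_sq]; ring
    have h2 : s / 2 ≤ Real.sinh (s / 2) := Real.self_le_sinh_iff.2 (by linarith)
    nlinarith
  rcases le_total 0 t with ht | ht
  · exact h t ht
  · have := h (-t) (by linarith)
    rwa [Real.cosh_neg, neg_sq] at this

lemma sq_half_le_sinh {t : ℝ} (ht : 0 ≤ t) : t ^ 2 / 2 ≤ Real.sinh t := by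
  have h1 := one_add_sq_half_le_cosh t
  have h2 := Real.cosh_sub_sinh t
  have h3 : Real.exp (-t) ≤ 1 := Real.exp_le_one_iff.2 (by linarith)
  linarith

lemma cosh_le_exp_of_nonneg {t : ℝ} (ht : 0 ≤ t) : Real.cosh t ≤ Real.exp t := by
  have h1 := Real.cosh_add_sinh t
  have h2 := Real.sinh_nonneg_iff.2 ht
  linarith

lemma exp_linear_sub_sq_le {x : ℝ} (hx : 0 < x) (b t : ℝ) :
    Real.exp (b * t - x * (t ^ 2 / 2)) ≤ Real.exp ((b + 1) ^ 2 / (2 * x)) * Real.exp (-t) := by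
  rw [← Real.exp_add]
  apply Real.exp_le_exp.2
  have : (b + 1) ^ 2 / (2 * x) + -t - (b * t - x * (t ^ 2 / 2))
      = (x * t - (b + 1)) ^ 2 / (2 * x) := by
    field_simp; ring
  have h2 : 0 ≤ (x * t - (b + 1)) ^ 2 / (2 * x) := by positivity
  linarith

lemma integrableOn_exp_neg_Ioi_zero : IntegrableOn (fun t : ℝ => Real.exp (-t)) (Ioi 0) :=
  integrableOn_exp_neg_Ioi 0

lemma cosh_pow_mul_exp_le {x : ℝ} (hx : 0 < x) (n : ℕ) {y t : ℝ} (hy : x ≤ y) (ht : 0 ≤ t) :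
    Real.cosh t ^ n * Real.exp (-y * Real.cosh t)
      ≤ Real.exp (((n : ℝ) + 1) ^ 2 / (2 * x)) * Real.exp (-t) := by
  have h1 : Real.cosh t ^ n ≤ Real.exp (n * t) := by
    rw [Real.exp_nat_mul]
    exact pow_le_pow_left₀ (Real.cosh_pos t).le (cosh_le_exp_of_nonneg ht) n
  have h2 : Real.exp (-y * Real.cosh t) ≤ Real.exp (-(x * (t ^ 2 / 2))) := by
    apply Real.exp_le_exp.2
    have := one_add_sq_half_le_cosh t
    have h3 : x * Real.cosh t ≤ y * Real.cosh t :=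
      mul_le_mul_of_nonneg_right hy (Real.cosh_pos t).le
    nlinarith
  calc _ ≤ Real.exp (n * t) * Real.exp (-(x * (t ^ 2 / 2))) := by gcongr
    _ = Real.exp (n * t - x * (t ^ 2 / 2)) := by rw [← Real.exp_add]; ring_nf
    _ ≤ _ := exp_linear_sub_sq_le hx n t

lemma integrableOn_cosh_pow_mul_exp {x : ℝ} (hx : 0 < x) (n : ℕ) :
    IntegrableOn (fun t => Real.cosh t ^ n * Real.exp (-x * Real.cosh t)) (Ioi 0) := by
  refine Integrable.mono'
    (integrableOn_exp_neg_Ioi_zero.const_mul (Real.exp (((n : ℝ) + 1) ^ 2 / (2 * x)))) ?_ ?_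
  · exact (by fun_prop : Continuous fun t =>
      Real.cosh t ^ n * Real.exp (-x * Real.cosh t)).aestronglyMeasurable
  · filter_upwards [ae_restrict_mem measurableSet_Ioi] with t ht
    rw [Real.norm_of_nonneg (by positivity)]
    exact cosh_pow_mul_exp_le hx n le_rfl (le_of_lt ht)

lemma hasDerivAt_coshMoment {x : ℝ} (hx : 0 < x) (n : ℕ) :
    HasDerivAt (coshMoment n) (-coshMoment (n + 1) x) x := by
  have h := (_root_.hasDerivAt_integral_of_dominated_loc_of_deriv_le
    (μ := volume.restrict (Ioi (0:ℝ))) (x₀ := x) (s := Ioi (x / 2))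
    (F := fun y t => Real.cosh t ^ n * Real.exp (-y * Real.cosh t))
    (F' := fun y t => -(Real.cosh t ^ (n + 1) * Real.exp (-y * Real.cosh t)))
    (bound := fun t => Real.exp ((((n + 1 : ℕ) : ℝ) + 1) ^ 2 / (2 * (x / 2))) * Real.exp (-t))
    (Ioi_mem_nhds (by linarith)) ?_ ?_ ?_ ?_ ?_ ?_).2
  · rw [MeasureTheory.integral_neg] at h
    exact h
  · exact Eventually.of_forall fun y => (by fun_prop : Continuous fun t =>
      Real.cosh t ^ n * Real.exp (-y * Real.cosh t)).aestronglyMeasurable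
  · exact integrableOn_cosh_pow_mul_exp hx n
  · exact (by fun_prop : Continuous fun t =>
      -(Real.cosh t ^ (n + 1) * Real.exp (-x * Real.cosh t))).aestronglyMeasurable
  · filter_upwards [ae_restrict_mem measurableSet_Ioi] with t ht y hy
    rw [norm_neg, Real.norm_of_nonneg (by positivity)]
    exact cosh_pow_mul_exp_le (by linarith) (n + 1) (le_of_lt hy) (le_of_lt ht)
  · exact integrableOn_exp_neg_Ioi_zero.const_mul _
  · filter_upwards with t y _
    have h1 : HasDerivAt (fun y : ℝ => -y * Real.cosh t) (-1 * Real.cosh t) y :=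
      (hasDerivAt_neg y).mul_const _
    have h2 := (h1.exp).const_mul (Real.cosh t ^ n)
    exact h2.congr_deriv (by ring)

lemma coshMoment_nonneg (n : ℕ) (x : ℝ) : 0 ≤ coshMoment n x :=
  setIntegral_nonneg measurableSet_Ioi fun t _ => by positivity

lemma coshMoment_one_eq {x : ℝ} (hx : 0 < x) :
    coshMoment 1 x = x * (coshMoment 2 x - coshMoment 0 x) := by
  have i0 := integrableOn_cosh_pow_mul_exp hx 0
  have i1 := integrableOn_cosh_pow_mul_exp hx 1
  have i2 := integrableOn_cosh_pow_mul_exp hx 2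
  have hint : IntegrableOn (fun t => Real.cosh t ^ 1 * Real.exp (-x * Real.cosh t)
      - x * (Real.cosh t ^ 2 * Real.exp (-x * Real.cosh t)
        - Real.cosh t ^ 0 * Real.exp (-x * Real.cosh t))) (Ioi 0) :=
    i1.sub ((i2.sub i0).const_mul x)
  have h := integral_Ioi_of_hasDerivAt_of_tendsto (a := (0:ℝ)) (m := 0)
    (f := fun t => Real.sinh t * Real.exp (-x * Real.cosh t))
    (f' := fun t => Real.cosh t ^ 1 * Real.exp (-x * Real.cosh t)
      - x * (Real.cosh t ^ 2 * Real.exp (-x * Real.cosh t)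
        - Real.cosh t ^ 0 * Real.exp (-x * Real.cosh t)))
    (by fun_prop) ?_ hint ?_
  · rw [MeasureTheory.integral_sub i1 (by exact (i2.sub i0).const_mul x),
      MeasureTheory.integral_const_mul, MeasureTheory.integral_sub i2 i0] at h
    simp only [Real.sinh_zero, zero_mul, sub_zero] at h
    unfold coshMoment
    linarith
  · intro t _
    have h1 : HasDerivAt (fun t : ℝ => -x * Real.cosh t) (-x * Real.sinh t) t :=
      (Real.hasDerivAt_cosh t).const_mul _
    refine ((Real.hasDerivAt_sinh t).mul h1.exp).congr_deriv ?_
    have := Real.cosh_sq t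
    simp only [this]; ring
  · have hlim : Tendsto (fun t : ℝ => Real.exp ((((1 : ℕ) : ℝ) + 1) ^ 2 / (2 * x)) * Real.exp (-t))
        atTop (nhds 0) := by
      simpa using (Real.tendsto_exp_neg_atTop_nhds_zero).const_mul
        (Real.exp ((((1 : ℕ) : ℝ) + 1) ^ 2 / (2 * x)))
    refine squeeze_zero' ?_ ?_ hlim
    · filter_upwards [eventually_ge_atTop 0] with t ht
      have := Real.sinh_nonneg_iff.2 ht
      positivity
    · filter_upwards [eventually_ge_atTop 0] with t ht
      refine le_trans ?_ (cosh_pow_mul_exp_le hx 1 le_rfl ht)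
      rw [pow_one]
      gcongr
      exact (Real.sinh_lt_cosh t).le

lemma hasDerivAt_K0 {x : ℝ} (hx : 0 < x) : HasDerivAt K0 (-coshMoment 1 x) x := by
  have h := hasDerivAt_coshMoment hx 0
  rwa [show coshMoment 0 = K0 from funext coshMoment_zero] at h

lemma K0_nonneg (x : ℝ) : 0 ≤ K0 x := coshMoment_zero x ▸ coshMoment_nonneg 0 x

lemma hasDerivAt_mul_coshMoment_one {x : ℝ} (hx : 0 < x) :
    HasDerivAt (fun y => y * coshMoment 1 y) (-(x * K0 x)) x := by
  refine ((hasDerivAt_id x).mul (hasDerivAt_coshMoment hx 1)).congr_deriv ?_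
  have := coshMoment_one_eq hx
  rw [coshMoment_zero] at this
  simp only [id, Nat.reduceAdd]
  rw [this]; ring

lemma integral_sinh_mul_exp {x : ℝ} (hx : 0 < x) :
    IntegrableOn (fun t => x * Real.sinh t * Real.exp (-x * Real.cosh t)) (Ioi 0) ∧
      ∫ t in Ioi (0:ℝ), x * Real.sinh t * Real.exp (-x * Real.cosh t) = Real.exp (-x) := by
  have hd : ∀ t ∈ Ioi (0:ℝ), HasDerivAt (fun t => -Real.exp (-x * Real.cosh t))
      (x * Real.sinh t * Real.exp (-x * Real.cosh t)) t := by
    intro t _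
    have h1 : HasDerivAt (fun t : ℝ => -x * Real.cosh t) (-x * Real.sinh t) t :=
      (Real.hasDerivAt_cosh t).const_mul _
    exact h1.exp.neg.congr_deriv (by ring)
  have hc : ContinuousWithinAt (fun t => -Real.exp (-x * Real.cosh t)) (Ici 0) 0 := by fun_prop
  have hp : ∀ t ∈ Ioi (0:ℝ), 0 ≤ x * Real.sinh t * Real.exp (-x * Real.cosh t) := by
    intro t ht
    have := Real.sinh_nonneg_iff.2 (le_of_lt ht)
    positivity
  have hl : Tendsto (fun t => -Real.exp (-x * Real.cosh t)) atTop (nhds 0) := by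
    have hlim : Tendsto (fun t : ℝ => Real.exp ((((0 : ℕ) : ℝ) + 1) ^ 2 / (2 * x)) * Real.exp (-t))
        atTop (nhds 0) := by
      have := (Real.tendsto_exp_neg_atTop_nhds_zero).const_mul
        (Real.exp ((((0 : ℕ) : ℝ) + 1) ^ 2 / (2 * x)))
      rwa [mul_zero] at this
    have : Tendsto (fun t => Real.exp (-x * Real.cosh t)) atTop (nhds 0) := by
      refine squeeze_zero' (Eventually.of_forall fun t => (Real.exp_pos _).le) ?_ hlim
      filter_upwards [eventually_ge_atTop 0] with t ht
      have := cosh_pow_mul_exp_le hx 0 le_rfl ht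
      rwa [pow_zero, one_mul] at this
    simpa using this.neg
  refine ⟨integrableOn_Ioi_deriv_of_nonneg hc hd hp hl, ?_⟩
  rw [integral_Ioi_of_hasDerivAt_of_nonneg hc hd hp hl]
  simp

lemma exp_neg_le_mul_coshMoment_one {x : ℝ} (hx : 0 < x) :
    Real.exp (-x) ≤ x * coshMoment 1 x := by
  obtain ⟨hi, he⟩ := integral_sinh_mul_exp hx
  rw [← he]
  unfold coshMoment
  rw [← MeasureTheory.integral_const_mul]
  refine setIntegral_mono_on hi ((integrableOn_cosh_pow_mul_exp hx 1).const_mul x)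
    measurableSet_Ioi fun t _ => ?_
  have := (Real.sinh_lt_cosh t).le
  rw [pow_one, mul_assoc]
  gcongr

lemma mul_coshMoment_one_le {x : ℝ} (hx : 0 < x) :
    x * coshMoment 1 x ≤ (1 + x) * Real.exp (-x) := by
  obtain ⟨hi, he⟩ := integral_sinh_mul_exp hx
  have hi2 : IntegrableOn (fun t => x * Real.exp (-x) * Real.exp (-t)) (Ioi 0) :=
    integrableOn_exp_neg_Ioi_zero.const_mul _
  have key : x * coshMoment 1 x ≤ ∫ t in Ioi (0:ℝ),
      (x * Real.sinh t * Real.exp (-x * Real.cosh t) + x * Real.exp (-x) * Real.exp (-t)) := by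
    unfold coshMoment
    rw [← MeasureTheory.integral_const_mul]
    refine setIntegral_mono_on ((integrableOn_cosh_pow_mul_exp hx 1).const_mul x) (hi.add hi2)
      measurableSet_Ioi fun t _ => ?_
    have h1 := Real.cosh_sub_sinh t
    have h2 : Real.exp (-x * Real.cosh t) ≤ Real.exp (-x) := by
      apply Real.exp_le_exp.2
      nlinarith [Real.one_le_cosh t]
    rw [pow_one, show Real.cosh t = Real.sinh t + Real.exp (-t) by linarith]
    rw [show Real.cosh t = Real.sinh t + Real.exp (-t) by linarith] at h2
    nlinarith [mul_le_mul_of_nonneg_left h2 (mul_pos hx (Real.exp_pos (-t))).le]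
  rw [MeasureTheory.integral_add hi hi2, he, MeasureTheory.integral_const_mul,
    integral_exp_neg_Ioi_zero] at key
  linarith

lemma K0_le {x : ℝ} (hx : 0 < x) : K0 x ≤ 2 * x ^ (-(1 / 2) : ℝ) * Real.exp (-x) := by
  have hg : IntegrableOn (fun t : ℝ => Real.exp (-x) * Real.exp (-(x / 2) * t ^ 2)) (Ioi 0) :=
    ((integrable_exp_neg_mul_sq (by linarith : 0 < x / 2)).integrableOn).const_mul _
  have h1 : K0 x ≤ ∫ t in Ioi (0:ℝ), Real.exp (-x) * Real.exp (-(x / 2) * t ^ 2) := by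
    have i0 := integrableOn_cosh_pow_mul_exp hx 0
    simp only [pow_zero, one_mul] at i0
    refine setIntegral_mono_on i0 hg measurableSet_Ioi fun t _ => ?_
    rw [← Real.exp_add]
    apply Real.exp_le_exp.2
    nlinarith [one_add_sq_half_le_cosh t]
  rw [MeasureTheory.integral_const_mul, integral_gaussian_Ioi] at h1
  refine h1.trans ?_
  rw [mul_comm]
  gcongr
  have h2 : √(π / (x / 2)) = √(2 * π) * x ^ (-(1 / 2) : ℝ) := by
    rw [Real.rpow_neg hx.le, ← Real.sqrt_eq_rpow, ← div_eq_mul_inv, ← Real.sqrt_div (by positivity)]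
    congr 1; field_simp
  have h3 : √(2 * π) ≤ 4 := by
    rw [Real.sqrt_le_left (by norm_num)]
    nlinarith [Real.pi_le_four]
  rw [h2]
  have : 0 ≤ x ^ (-(1 / 2) : ℝ) := by positivity
  nlinarith

/-- The kernels `(x d/dx)^j K₀(x)` for `j ≤ 3`. -/
noncomputable def eulerK0 : ℕ → ℝ → ℝ
  | 0 => K0
  | 1 => fun x => -(x * coshMoment 1 x)
  | 2 => fun x => x ^ 2 * K0 x
  | _ => fun x => 2 * x ^ 2 * K0 x - x ^ 2 * (x * coshMoment 1 x)

lemma hasDerivAt_eulerK0 {j : ℕ} (hj : j < 3) {x : ℝ} (hx : 0 < x) :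
    HasDerivAt (eulerK0 j) (eulerK0 (j + 1) x / x) x := by
  interval_cases j
  · refine (hasDerivAt_K0 hx).congr_deriv ?_
    simp only [eulerK0]; field_simp
  · refine (hasDerivAt_mul_coshMoment_one hx).neg.congr_deriv ?_
    simp only [eulerK0]; field_simp
  · refine (((hasDerivAt_id x).pow 2).mul (hasDerivAt_K0 hx)).congr_deriv ?_
    simp [eulerK0]; field_simp; ring

lemma continuousOn_eulerK0 (j : ℕ) : ContinuousOn (eulerK0 j) (Ioi 0) := by
  have h0 : ContinuousOn K0 (Ioi 0) := fun x hx => (hasDerivAt_K0 hx).continuousAt.continuousWithinAt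
  have h1 : ContinuousOn (fun x => x * coshMoment 1 x) (Ioi 0) :=
    fun x hx => (hasDerivAt_mul_coshMoment_one hx).continuousAt.continuousWithinAt
  match j with
  | 0 => exact h0
  | 1 => exact h1.neg
  | 2 => exact (continuousOn_id.pow 2).mul h0
  | _ + 3 =>
    exact ((continuousOn_const.mul (continuousOn_id.pow 2)).mul h0).sub
      ((continuousOn_id.pow 2).mul h1)

lemma one_add_pow_four_le {x : ℝ} (hx : 0 < x) :
    (1 + x) ^ 4 * Real.exp (-x) ≤ 4096 * Real.exp (-x / 2) := by
  have h1 : (1 + x) / 8 ≤ Real.exp (x / 8) := by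
    have := Real.add_one_le_exp (x / 8)
    linarith
  have h2 : ((1 + x) / 8) ^ 4 ≤ Real.exp (x / 8) ^ 4 := pow_le_pow_left₀ (by positivity) h1 4
  rw [← Real.exp_nat_mul] at h2
  have h3 : Real.exp (-x / 2) = Real.exp ((4 : ℕ) * (x / 8)) * Real.exp (-x) := by
    rw [← Real.exp_add]; congr 1; push_cast; ring
  rw [h3]
  have h4 := Real.exp_pos (-x)
  have h5 : (1 + x) ^ 4 ≤ 4096 * Real.exp ((4 : ℕ) * (x / 8)) := by
    linarith [h2, show ((1 + x) / 8) ^ 4 = (1 + x) ^ 4 / 4096 by ring]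
  nlinarith

lemma abs_eulerK0_le (j : ℕ) {x : ℝ} (hx : 0 < x) :
    |eulerK0 j x| ≤ 20480 * x ^ (-(1 / 2) : ℝ) * Real.exp (-x / 2) := by
  set r := x ^ (-(1 / 2) : ℝ) with hr
  have hr0 : 0 < r := Real.rpow_pos_of_pos hx _
  have hr2 : r * r * x = 1 := by
    rw [hr, ← Real.rpow_add hx]
    norm_num [Real.rpow_neg_one, hx.ne']
  have hr1 : 1 ≤ (1 + x) * r := by
    by_contra! h
    have h2 : ((1 + x) * r) ^ 2 < 1 := by nlinarith [mul_pos (by linarith : 0 < 1 + x) hr0]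
    have h3 : (r * r) * (1 + x + x ^ 2) < 0 + (1 - r * r * x) := by nlinarith
    nlinarith [mul_pos hr0 hr0, mul_pos (mul_pos hr0 hr0) hx]
  have he := Real.exp_pos (-x)
  have hk := K0_le hx
  have hk0 := K0_nonneg x
  have hm := mul_coshMoment_one_le hx
  have hm0 : 0 ≤ x * coshMoment 1 x := mul_nonneg hx.le (coshMoment_nonneg 1 x)
  have hfin : 5 * (1 + x) ^ 4 * r * Real.exp (-x) ≤ 20480 * r * Real.exp (-x / 2) := by
    have := mul_le_mul_of_nonneg_left (one_add_pow_four_le hx) hr0.le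
    linarith
  refine le_trans ?_ hfin
  have hK : K0 x ≤ 2 * (r * Real.exp (-x)) := by linarith
  have hM : x * coshMoment 1 x ≤ (1 + x) ^ 2 * (r * Real.exp (-x)) := by
    refine hm.trans ?_
    have : (1 + x) * 1 ≤ (1 + x) * ((1 + x) * r) := by gcongr
    nlinarith
  rw [show 5 * (1 + x) ^ 4 * r * Real.exp (-x) = 5 * (1 + x) ^ 4 * (r * Real.exp (-x)) by ring]
  have hs : 0 < r * Real.exp (-x) := by positivity
  set s := r * Real.exp (-x)
  have p0 : 1 ≤ (1 + x) ^ 4 := one_le_pow₀ (by linarith)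
  have p2 : (1 + x) ^ 2 ≤ (1 + x) ^ 4 := pow_le_pow_right₀ (by linarith) (by norm_num)
  have p3 : x ^ 2 ≤ (1 + x) ^ 2 := pow_le_pow_left₀ hx.le (by linarith) 2
  have p4 : x ^ 2 * (1 + x) ^ 2 ≤ (1 + x) ^ 4 := by nlinarith
  have q2 : x ^ 2 * K0 x ≤ (1 + x) ^ 4 * (2 * s) := by
    have := mul_le_mul_of_nonneg_right (p3.trans p2) hk0
    have := mul_le_mul_of_nonneg_left hK (by linarith : 0 ≤ (1 + x) ^ 4)
    linarith
  match j with
  | 0 =>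
    simp only [eulerK0]
    rw [abs_of_nonneg hk0]
    nlinarith
  | 1 =>
    simp only [eulerK0]
    rw [abs_neg, abs_of_nonneg hm0]
    nlinarith
  | 2 =>
    simp only [eulerK0]
    rw [abs_of_nonneg (by positivity)]
    nlinarith
  | _ + 3 =>
    simp only [eulerK0]
    have q3 : x ^ 2 * (x * coshMoment 1 x) ≤ (1 + x) ^ 4 * s := by
      have := mul_le_mul_of_nonneg_left hM (by positivity : 0 ≤ x ^ 2)
      nlinarith
    have q4 : 0 ≤ x ^ 2 * K0 x := by positivity
    have q5 : 0 ≤ x ^ 2 * (x * coshMoment 1 x) := by positivity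
    have q6 : 0 ≤ (1 + x) ^ 4 * s := by positivity
    rw [abs_le]
    constructor <;> linarith

/-- Continuous weights of at most exponential growth on the half-line. -/
def ExpWeight (g : ℝ → ℝ) : Prop :=
  Continuous g ∧ ∃ A b : ℝ, ∀ t : ℝ, 0 < t → |g t| ≤ A * Real.exp (b * t)

lemma expWeight_exp (ν : ℝ) : ExpWeight fun t => Real.exp (-2 * ν * t) :=
  ⟨by fun_prop, 1, -2 * ν, fun t _ => by rw [Real.abs_exp, one_mul]⟩

lemma expWeight_mul_exp (ν : ℝ) : ExpWeight fun t => -2 * t * Real.exp (-2 * ν * t) := by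
  refine ⟨by fun_prop, 2, -2 * ν + 1, fun t ht => ?_⟩
  rw [abs_mul, Real.abs_exp, add_mul, Real.exp_add]
  have h1 : |-2 * t| ≤ 2 * Real.exp (1 * t) := by
    rw [abs_mul, abs_of_pos ht]
    have := Real.add_one_le_exp (1 * t)
    norm_num at this ⊢
    linarith
  have := Real.exp_pos (-2 * ν * t)
  nlinarith

/-- The dominating function's constant. -/
noncomputable def domConst (z b : ℝ) : ℝ :=
  20480 * (2 * z) ^ (-(1 / 2) : ℝ) * Real.exp ((b + 1) ^ 2 / (2 * z))

lemma abs_eulerK0_sinh_mul_exp_le (j : ℕ) {z₀ z t : ℝ} (b : ℝ) (hz₀ : 0 < z₀) (hz : z₀ ≤ z)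
    (ht : 0 < t) :
    |eulerK0 j (2 * z * Real.sinh t)| * Real.exp (b * t)
      ≤ domConst z₀ b * (Real.exp (-t) * t ^ ((1 / 2 : ℝ) - 1)) := by
  have hs : t ≤ Real.sinh t := Real.self_le_sinh_iff.2 ht.le
  have hx : 2 * z₀ * t ≤ 2 * z * Real.sinh t := by
    have : z₀ * t ≤ z * Real.sinh t := by gcongr; linarith
    linarith
  have hx0 : 0 < 2 * z₀ * t := by positivity
  have h1 : (2 * z * Real.sinh t) ^ (-(1 / 2) : ℝ) 
      ≤ (2 * z₀) ^ (-(1 / 2) : ℝ) * t ^ ((1 / 2 : ℝ) - 1) := by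
    rw [show ((1 / 2 : ℝ) - 1) = -(1 / 2) by norm_num, ← Real.mul_rpow (by positivity) ht.le]
    exact Real.rpow_le_rpow_of_nonpos hx0 hx (by norm_num)
  have h2 : Real.exp (-(2 * z * Real.sinh t) / 2) * Real.exp (b * t)
      ≤ Real.exp ((b + 1) ^ 2 / (2 * z₀)) * Real.exp (-t) := by
    refine le_trans ?_ (exp_linear_sub_sq_le hz₀ b t)
    rw [← Real.exp_add]
    apply Real.exp_le_exp.2
    have h3 := sq_half_le_sinh ht.le
    have : z₀ * (t ^ 2 / 2) ≤ z * Real.sinh t := by gcongr; linarith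
    linarith
  calc _ ≤ 20480 * (2 * z * Real.sinh t) ^ (-(1 / 2) : ℝ)
        * Real.exp (-(2 * z * Real.sinh t) / 2) * Real.exp (b * t) := by
        gcongr
        exact abs_eulerK0_le j (hx0.trans_le hx)
    _ = 20480 * (2 * z * Real.sinh t) ^ (-(1 / 2) : ℝ)
        * (Real.exp (-(2 * z * Real.sinh t) / 2) * Real.exp (b * t)) := by ring
    _ ≤ 20480 * ((2 * z₀) ^ (-(1 / 2) : ℝ) * t ^ ((1 / 2 : ℝ) - 1))
        * (Real.exp ((b + 1) ^ 2 / (2 * z₀)) * Real.exp (-t)) := by gcongr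
    _ = _ := by unfold domConst; ring

lemma integrableOn_exp_neg_mul_rpow (C : ℝ) :
    IntegrableOn (fun t : ℝ => C * (Real.exp (-t) * t ^ ((1 / 2 : ℝ) - 1))) (Ioi 0) :=
  (Real.GammaIntegral_convergent (by norm_num)).const_mul C

/-- The integral transform of a weight against the kernel `eulerK0 j`. -/
noncomputable def nicholson (j : ℕ) (g : ℝ → ℝ) (z : ℝ) : ℝ :=
  ∫ t in Ioi (0:ℝ), eulerK0 j (2 * z * Real.sinh t) * g t

lemma aestronglyMeasurable_nicholson (j : ℕ) {g : ℝ → ℝ} (hg : Continuous g) {z : ℝ} (hz : 0 < z) :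
    AEStronglyMeasurable (fun t => eulerK0 j (2 * z * Real.sinh t) * g t)
      (volume.restrict (Ioi 0)) := by
  refine ContinuousOn.aestronglyMeasurable ?_ measurableSet_Ioi
  refine ((continuousOn_eulerK0 j).comp (by fun_prop) ?_).mul hg.continuousOn
  intro t ht
  have := Real.sinh_pos_iff.2 ht
  exact mem_Ioi.2 (by positivity)

lemma integrableOn_nicholson (j : ℕ) {g : ℝ → ℝ} (hg : ExpWeight g) {z : ℝ} (hz : 0 < z) :
    IntegrableOn (fun t => eulerK0 j (2 * z * Real.sinh t) * g t) (Ioi 0) := by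
  obtain ⟨hc, A, b, hA⟩ := hg
  refine Integrable.mono' (integrableOn_exp_neg_mul_rpow (A * domConst z b))
    (aestronglyMeasurable_nicholson j hc hz) ?_
  filter_upwards [ae_restrict_mem measurableSet_Ioi] with t ht
  have h1 := abs_eulerK0_sinh_mul_exp_le j b hz le_rfl ht
  have h2 := hA t ht
  have hA0 : 0 ≤ A := by
    have := (abs_nonneg _).trans h2
    exact nonneg_of_mul_nonneg_left this (Real.exp_pos _)
  rw [norm_mul, Real.norm_eq_abs, Real.norm_eq_abs]
  calc _ ≤ |eulerK0 j (2 * z * Real.sinh t)| * (A * Real.exp (b * t)) := by gcongr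
    _ = A * (|eulerK0 j (2 * z * Real.sinh t)| * Real.exp (b * t)) := by ring
    _ ≤ A * (domConst z b * (Real.exp (-t) * t ^ ((1 / 2 : ℝ) - 1))) := by gcongr
    _ = _ := by ring

lemma hasDerivAt_nicholson {j : ℕ} (hj : j < 3) {g : ℝ → ℝ} (hg : ExpWeight g) {z : ℝ}
    (hz : 0 < z) : HasDerivAt (nicholson j g) (nicholson (j + 1) g z / z) z := by
  obtain ⟨hc, A, b, hA⟩ := id hg
  have h := (_root_.hasDerivAt_integral_of_dominated_loc_of_deriv_le
    (μ := volume.restrict (Ioi (0:ℝ))) (x₀ := z) (s := Ioi (z / 2))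
    (F := fun y t => eulerK0 j (2 * y * Real.sinh t) * g t)
    (F' := fun y t => eulerK0 (j + 1) (2 * y * Real.sinh t) * g t / y)
    (bound := fun t => (2 / z) * A * domConst (z / 2) b * (Real.exp (-t) * t ^ ((1 / 2 : ℝ) - 1)))
    (Ioi_mem_nhds (by linarith)) ?_ ?_ ?_ ?_ ?_ ?_).2
  · rw [MeasureTheory.integral_div] at h
    exact h
  · filter_upwards [Ioi_mem_nhds hz] with y hy
    exact aestronglyMeasurable_nicholson j hc hy
  · exact integrableOn_nicholson j hg hz
  · simp only [div_eq_mul_inv]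
    exact (aestronglyMeasurable_nicholson (j + 1) hc hz).mul_const _
  · filter_upwards [ae_restrict_mem measurableSet_Ioi] with t ht y hy
    have hy0 : 0 < y := lt_trans (by positivity) hy
    have h1 := abs_eulerK0_sinh_mul_exp_le (j + 1) b (half_pos hz) (le_of_lt hy) ht
    have h2 := hA t ht
    have hA0 : 0 ≤ A := nonneg_of_mul_nonneg_left ((abs_nonneg _).trans h2) (Real.exp_pos _)
    have h3 : y⁻¹ ≤ 2 / z := by
      rw [← one_div, div_le_div_iff₀ hy0 hz]
      have : z / 2 < y := hy
      linarith
    rw [norm_div, norm_mul, Real.norm_eq_abs, Real.norm_eq_abs, Real.norm_of_nonneg hy0.le,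
      div_eq_mul_inv]
    calc _ ≤ |eulerK0 (j + 1) (2 * y * Real.sinh t)| * (A * Real.exp (b * t)) * (2 / z) := by gcongr
      _ = (2 / z) * A * (|eulerK0 (j + 1) (2 * y * Real.sinh t)| * Real.exp (b * t)) := by ring
      _ ≤ (2 / z) * A * (domConst (z / 2) b * (Real.exp (-t) * t ^ ((1 / 2 : ℝ) - 1))) := by gcongr
      _ = _ := by ring
  · exact integrableOn_exp_neg_mul_rpow _
  · filter_upwards [ae_restrict_mem measurableSet_Ioi] with t ht y hy
    have hy0 : 0 < y := lt_trans (by positivity) hy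
    have hs := Real.sinh_pos_iff.2 ht
    have h1 : HasDerivAt (fun y : ℝ => 2 * y * Real.sinh t) (2 * 1 * Real.sinh t) y :=
      ((hasDerivAt_id y).const_mul 2).mul_const _
    refine ((HasDerivAt.comp y (hasDerivAt_eulerK0 hj
      (by positivity : 0 < 2 * y * Real.sinh t)) h1).mul_const (g t)).congr_deriv ?_
    field_simp

lemma hasDerivAt_nicholson_order (j : ℕ) {z : ℝ} (hz : 0 < z) (ν : ℝ) :
    HasDerivAt (fun μ => nicholson j (fun t => Real.exp (-2 * μ * t)) z)
      (nicholson j (fun t => -2 * t * Real.exp (-2 * ν * t)) z) ν := by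
  set b : ℝ := 2 * (|ν| + 1) + 1 with hb
  refine (_root_.hasDerivAt_integral_of_dominated_loc_of_deriv_le
    (μ := volume.restrict (Ioi (0:ℝ))) (x₀ := ν) (s := Metric.ball ν 1)
    (F := fun μ t => eulerK0 j (2 * z * Real.sinh t) * Real.exp (-2 * μ * t))
    (F' := fun μ t => eulerK0 j (2 * z * Real.sinh t) * (-2 * t * Real.exp (-2 * μ * t)))
    (bound := fun t => 2 * domConst z b * (Real.exp (-t) * t ^ ((1 / 2 : ℝ) - 1)))
    (Metric.ball_mem_nhds _ one_pos) ?_ ?_ ?_ ?_ ?_ ?_).2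
  · exact Eventually.of_forall fun μ =>
      aestronglyMeasurable_nicholson j (expWeight_exp μ).1 hz
  · exact integrableOn_nicholson j (expWeight_exp ν) hz
  · exact aestronglyMeasurable_nicholson j (expWeight_mul_exp ν).1 hz
  · filter_upwards [ae_restrict_mem measurableSet_Ioi] with t ht μ hμ
    have ht0 : 0 < t := ht
    have h1 := abs_eulerK0_sinh_mul_exp_le j b hz le_rfl ht
    have h2 : |(-2 * t * Real.exp (-2 * μ * t))| ≤ 2 * Real.exp (b * t) := by
      rw [abs_mul, Real.abs_exp, abs_mul, abs_of_pos ht0, hb, add_mul _ (1:ℝ), Real.exp_add]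
      have h3 : t ≤ Real.exp (1 * t) := by
        have := Real.add_one_le_exp (1 * t)
        linarith
      have h4 : Real.exp (-2 * μ * t) ≤ Real.exp (2 * (|ν| + 1) * t) := by
        apply Real.exp_le_exp.2
        have h5 : |μ - ν| < 1 := hμ
        have h6 : -μ ≤ |ν| + 1 := by
          have := neg_abs_le ν
          have := (abs_lt.1 h5).1
          linarith
        nlinarith
      rw [show |(-2 : ℝ)| = 2 by norm_num]
      have := mul_le_mul h3 h4 (Real.exp_pos _).le (Real.exp_pos _).le
      linarith
    rw [norm_mul, Real.norm_eq_abs, Real.norm_eq_abs]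
    calc _ ≤ |eulerK0 j (2 * z * Real.sinh t)| * (2 * Real.exp (b * t)) := by gcongr
      _ = 2 * (|eulerK0 j (2 * z * Real.sinh t)| * Real.exp (b * t)) := by ring
      _ ≤ 2 * (domConst z b * (Real.exp (-t) * t ^ ((1 / 2 : ℝ) - 1))) := by gcongr
      _ = _ := by ring
  · exact integrableOn_exp_neg_mul_rpow _
  · filter_upwards with t μ _
    have h1 : HasDerivAt (fun μ : ℝ => -2 * μ * t) (-2 * 1 * t) μ :=
      ((hasDerivAt_id μ).const_mul (-2)).mul_const _
    refine (h1.exp.const_mul (eulerK0 j (2 * z * Real.sinh t))).congr_deriv ?_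
    ring

lemma nicholson_abs_le (j n : ℕ) (ν : ℝ) :
    ∃ K : ℝ, ∀ z : ℝ, 0 < z → 4 * |ν| ≤ z → ∀ g : ℝ → ℝ,
      (∀ t, 0 < t → |g t| ≤ 2 * t ^ n * Real.exp (2 * |ν| * t)) →
      |nicholson j g z| ≤ K / z ^ (n + 1) := by
  refine ⟨40960 * 2 ^ n * Real.Gamma (n + 1 / 2), fun z hz hν g hg => ?_⟩
  set B : ℝ → ℝ := fun t => 40960 * (2 * z) ^ (-(1 / 2) : ℝ) *
    (t ^ (((n : ℝ) + 1 / 2) - 1) * Real.exp (-(z / 2 * t))) with hB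
  have hBi : IntegrableOn B (Ioi 0) := by
    have hn : (-1 : ℝ) < ((n : ℝ) + 1 / 2) - 1 := by
      have : (0:ℝ) ≤ n := n.cast_nonneg
      linarith
    have h := (integrableOn_rpow_mul_exp_neg_mul_rpow hn one_pos (half_pos hz)).const_mul
      (40960 * (2 * z) ^ (-(1 / 2) : ℝ))
    simp only [Real.rpow_one, neg_mul] at h
    exact h
  have hle : ∀ t ∈ Ioi (0:ℝ), ‖eulerK0 j (2 * z * Real.sinh t) * g t‖ ≤ B t := by
    intro t ht
    have ht0 : 0 < t := ht
    have hs : t ≤ Real.sinh t := Real.self_le_sinh_iff.2 ht0.le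
    have hzt : z * t ≤ z * Real.sinh t := by gcongr
    have hx0 : 0 < 2 * z * t := by positivity
    have hx : 2 * z * t ≤ 2 * z * Real.sinh t := by gcongr
    have h1 : (2 * z * Real.sinh t) ^ (-(1 / 2) : ℝ)
        ≤ (2 * z) ^ (-(1 / 2) : ℝ) * t ^ (-(1 / 2) : ℝ) := by
      rw [← Real.mul_rpow (by positivity) ht0.le]
      exact Real.rpow_le_rpow_of_nonpos hx0 hx (by norm_num)
    have h2 : Real.exp (-(2 * z * Real.sinh t) / 2) * Real.exp (2 * |ν| * t)
        ≤ Real.exp (-(z / 2 * t)) := by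
      rw [← Real.exp_add]
      apply Real.exp_le_exp.2
      nlinarith
    have h3 : t ^ (((n : ℝ) + 1 / 2) - 1) = t ^ (-(1 / 2) : ℝ) * t ^ n := by
      rw [← Real.rpow_natCast, ← Real.rpow_add ht0]
      congr 1; ring
    rw [norm_mul, Real.norm_eq_abs, Real.norm_eq_abs]
    calc _ ≤ (20480 * (2 * z * Real.sinh t) ^ (-(1 / 2) : ℝ)
          * Real.exp (-(2 * z * Real.sinh t) / 2)) * (2 * t ^ n * Real.exp (2 * |ν| * t)) := by
          gcongr
          · exact abs_eulerK0_le j (hx0.trans_le hx)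
          · exact hg t ht0
      _ = 40960 * t ^ n * (2 * z * Real.sinh t) ^ (-(1 / 2) : ℝ)
          * (Real.exp (-(2 * z * Real.sinh t) / 2) * Real.exp (2 * |ν| * t)) := by ring
      _ ≤ 40960 * t ^ n * ((2 * z) ^ (-(1 / 2) : ℝ) * t ^ (-(1 / 2) : ℝ))
          * Real.exp (-(z / 2 * t)) := by gcongr
      _ = B t := by simp only [hB, h3]; ring
  have h := norm_integral_le_of_norm_le hBi
    ((ae_restrict_mem measurableSet_Ioi).mono hle)
  refine h.trans (le_of_eq ?_)
  simp only [hB]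
  rw [MeasureTheory.integral_const_mul, Real.integral_rpow_mul_exp_neg_mul_Ioi
    (by positivity) (half_pos hz)]
  have h4 : (1 / (z / 2)) ^ ((n : ℝ) + 1 / 2) = 2 ^ n * (2 * 2⁻¹) / z ^ n * (2 / z) ^ (1 / 2 : ℝ) := by
    rw [show 1 / (z / 2) = 2 / z by field_simp, Real.rpow_add (by positivity), Real.rpow_natCast,
      div_pow]
    ring
  have h5 : (2 * z) ^ (-(1 / 2) : ℝ) * (2 / z) ^ (1 / 2 : ℝ) = 1 / z := by
    rw [Real.rpow_neg (by positivity), ← Real.inv_rpow (by positivity),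
      ← Real.mul_rpow (by positivity) (by positivity),
      show (2 * z)⁻¹ * (2 / z) = (1 / z) ^ (2 : ℝ) by
        rw [Real.rpow_two]; field_simp, ← Real.rpow_mul (by positivity)]
    norm_num
  rw [h4]
  calc _ = 40960 * 2 ^ n / z ^ n * ((2 * z) ^ (-(1 / 2) : ℝ) * (2 / z) ^ (1 / 2 : ℝ))
        * Real.Gamma (n + 1 / 2) := by ring
    _ = _ := by rw [h5, pow_succ]; field_simp

lemma exp_order_abs_le (ν t : ℝ) (ht : 0 < t) :
    |Real.exp (-2 * ν * t)| ≤ 2 * t ^ 0 * Real.exp (2 * |ν| * t) := by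
  rw [Real.abs_exp]
  have : Real.exp (-2 * ν * t) ≤ Real.exp (2 * |ν| * t) := by
    apply Real.exp_le_exp.2
    nlinarith [neg_abs_le ν]
  have := Real.exp_pos (2 * |ν| * t)
  simp only [pow_zero]
  linarith

lemma mul_exp_order_abs_le (ν t : ℝ) (ht : 0 < t) :
    |-2 * t * Real.exp (-2 * ν * t)| ≤ 2 * t ^ 1 * Real.exp (2 * |ν| * t) := by
  rw [abs_mul, Real.abs_exp, abs_mul, abs_of_pos ht, abs_neg, abs_two, pow_one]
  refine mul_le_mul_of_nonneg_left (Real.exp_le_exp.2 ?_) (by positivity)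
  nlinarith [neg_abs_le ν]

lemma nicholson_zero_half_le {z : ℝ} (hz : 0 < z) :
    z * nicholson 0 (fun t => Real.exp (-2 * (1 / 2) * t)) z
      ≤ 20480 * Real.Gamma (1 / 2) * z ^ (1 / 2 : ℝ) := by
  have hi : IntegrableOn (fun t : ℝ => 20480 * z ^ (-(1 / 2) : ℝ) *
      (Real.exp (-t) * t ^ ((1 / 2 : ℝ) - 1))) (Ioi 0) := integrableOn_exp_neg_mul_rpow _
  have h : nicholson 0 (fun t => Real.exp (-2 * (1 / 2) * t)) z
      ≤ ∫ t in Ioi (0:ℝ), 20480 * z ^ (-(1 / 2) : ℝ) * (Real.exp (-t) * t ^ ((1 / 2 : ℝ) - 1)) := by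
    refine setIntegral_mono_on (integrableOn_nicholson 0 (expWeight_exp _) hz) hi
      measurableSet_Ioi fun t ht => ?_
    have ht0 : 0 < t := ht
    have hs : t ≤ Real.sinh t := Real.self_le_sinh_iff.2 ht0.le
    have hx0 : 0 < z * t := by positivity
    have hx : z * t ≤ 2 * z * Real.sinh t := by nlinarith
    have h1 : (2 * z * Real.sinh t) ^ (-(1 / 2) : ℝ)
        ≤ z ^ (-(1 / 2) : ℝ) * t ^ ((1 / 2 : ℝ) - 1) := by
      rw [show ((1 / 2 : ℝ) - 1) = -(1 / 2) by norm_num, ← Real.mul_rpow (by positivity) ht0.le]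
      exact Real.rpow_le_rpow_of_nonpos hx0 hx (by norm_num)
    have h2 := (le_abs_self _).trans (abs_eulerK0_le 0 (hx0.trans_le hx))
    have h3 : Real.exp (-(2 * z * Real.sinh t) / 2) ≤ 1 := Real.exp_le_one_iff.2 (by linarith)
    calc _ ≤ (20480 * (z ^ (-(1 / 2) : ℝ) * t ^ ((1 / 2 : ℝ) - 1)) * 1)
          * Real.exp (-2 * (1 / 2) * t) := by
          gcongr
          refine h2.trans ?_
          gcongr
      _ = _ := by rw [show -2 * (1 / 2) * t = -t by ring]; ring
  rw [MeasureTheory.integral_const_mul, ← Real.Gamma_eq_integral (by norm_num)] at h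
  have h2 := mul_le_mul_of_nonneg_left h hz.le
  refine h2.trans (le_of_eq ?_)
  have : z ^ (1 / 2 : ℝ) = z * z ^ (-(1 / 2) : ℝ) := by
    conv_rhs => rw [← Real.rpow_one_add' hz.le (by norm_num)]
    norm_num
  rw [this]; ring

lemma hasDerivAt_sinh_scale (z t : ℝ) :
    HasDerivAt (fun t => 2 * z * Real.sinh t) (2 * z * Real.cosh t) t :=
  (Real.hasDerivAt_sinh t).const_mul _

lemma nicholson_third_order (ν : ℝ) {z : ℝ} (hz : 0 < z) :
    nicholson 3 (fun t => Real.exp (-2 * ν * t)) z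
      + 4 * z ^ 2 * (nicholson 1 (fun t => Real.exp (-2 * ν * t)) z
        + nicholson 0 (fun t => Real.exp (-2 * ν * t)) z)
      = 4 * ν ^ 2 * nicholson 1 (fun t => Real.exp (-2 * ν * t)) z + 2 * ν := by
  set e : ℝ → ℝ := fun t => Real.exp (-2 * ν * t) with he
  have hw : ExpWeight e := expWeight_exp ν
  have i0 := integrableOn_nicholson 0 hw hz
  have i1 := integrableOn_nicholson 1 hw hz
  have i3 := integrableOn_nicholson 3 hw hz
  set F : ℝ → ℝ := fun t => (2 * z * Real.sinh t) * K0 (2 * z * Real.sinh t) * (2 * z * Real.cosh t) * e t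
    + 2 * ν * eulerK0 1 (2 * z * Real.sinh t) * e t with hF
  set F' : ℝ → ℝ := fun t => eulerK0 3 (2 * z * Real.sinh t) * e t
    + 4 * z ^ 2 * (eulerK0 1 (2 * z * Real.sinh t) * e t + eulerK0 0 (2 * z * Real.sinh t) * e t)
    - 4 * ν ^ 2 * (eulerK0 1 (2 * z * Real.sinh t) * e t) with hF'
  have hi' : IntegrableOn F' (Ioi 0) := (i3.add ((i1.add i0).const_mul _)).sub (i1.const_mul _)
  have hed : ∀ t, HasDerivAt e (-2 * ν * e t) t := by
    intro t
    have h1 : HasDerivAt (fun t : ℝ => -2 * ν * t) (-2 * ν * 1) t := (hasDerivAt_id t).const_mul _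
    exact h1.exp.congr_deriv (by simp only [he]; ring)
  have hderiv : ∀ t ∈ Ioi (0:ℝ), HasDerivAt F (F' t) t := by
    intro t ht
    have hs := Real.sinh_pos_iff.2 ht
    have hx : 0 < 2 * z * Real.sinh t := by positivity
    have hX := hasDerivAt_sinh_scale z t
    have hK := HasDerivAt.comp t (hasDerivAt_K0 hx) hX
    have hE := HasDerivAt.comp t (hasDerivAt_eulerK0 (j := 1) (by norm_num) hx) hX
    have hC : HasDerivAt (fun t => 2 * z * Real.cosh t) (2 * z * Real.sinh t) t :=
      (Real.hasDerivAt_cosh t).const_mul _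
    refine (((hX.mul hK).mul hC |>.mul (hed t)).add
      ((hE.const_mul (2 * ν)).mul (hed t))).congr_deriv ?_
    have hc := Real.cosh_sq t
    simp only [hF', eulerK0, Function.comp_apply, Pi.mul_apply, Nat.reduceAdd]
    field_simp
    ring_nf
    rw [hc]
    ring
  have hzero : Tendsto F (nhdsWithin 0 (Ioi 0)) (nhds (-2 * ν)) := by
    have hx0 : Tendsto (fun t : ℝ => 2 * z * Real.sinh t) (nhdsWithin 0 (Ioi 0))
        (nhdsWithin 0 (Ioi 0)) := by
      refine tendsto_nhdsWithin_iff.2 ⟨?_, ?_⟩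
      · have : ContinuousAt (fun t : ℝ => 2 * z * Real.sinh t) 0 := by fun_prop
        have h := this.tendsto
        simp only [Real.sinh_zero, mul_zero] at h
        exact h.mono_left nhdsWithin_le_nhds
      · filter_upwards [self_mem_nhdsWithin] with t ht
        have hs := Real.sinh_pos_iff.2 ht
        exact mem_Ioi.2 (by positivity)
    have hxK : Tendsto (fun x => x * K0 x) (nhdsWithin 0 (Ioi 0)) (nhds 0) := by
      have hlim : Tendsto (fun x : ℝ => 2 * x ^ (1 / 2 : ℝ)) (nhdsWithin 0 (Ioi 0)) (nhds 0) := by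
        have h1 : ContinuousAt (fun x : ℝ => 2 * x ^ (1 / 2 : ℝ)) 0 :=
          continuousAt_const.mul (Real.continuousAt_rpow_const _ _ (Or.inr (by norm_num)))
        have h := h1.tendsto
        rw [Real.zero_rpow (by norm_num), mul_zero] at h
        exact h.mono_left nhdsWithin_le_nhds
      refine squeeze_zero' ?_ ?_ hlim
      · filter_upwards [self_mem_nhdsWithin] with x hx
        exact mul_nonneg (le_of_lt hx) (K0_nonneg x)
      · filter_upwards [self_mem_nhdsWithin] with x hx
        have hx0 : 0 < x := hx
        have h1 : x ^ (1 / 2 : ℝ) = x * x ^ (-(1 / 2) : ℝ) := by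
          conv_rhs => rw [← Real.rpow_one_add' hx0.le (by norm_num)]
          norm_num
        have h2 : Real.exp (-x) ≤ 1 := Real.exp_le_one_iff.2 (by linarith)
        calc x * K0 x ≤ x * (2 * x ^ (-(1 / 2) : ℝ) * Real.exp (-x)) := by
              gcongr; exact K0_le hx0
          _ ≤ x * (2 * x ^ (-(1 / 2) : ℝ) * 1) := by gcongr
          _ = _ := by rw [h1]; ring
    have hxK1 : Tendsto (fun x => x * coshMoment 1 x) (nhdsWithin 0 (Ioi 0)) (nhds 1) := by
      have hl : Tendsto (fun x : ℝ => Real.exp (-x)) (nhdsWithin 0 (Ioi 0)) (nhds 1) := by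
        have : ContinuousAt (fun x : ℝ => Real.exp (-x)) 0 := by fun_prop
        have h := this.tendsto
        simp only [neg_zero, Real.exp_zero] at h
        exact h.mono_left nhdsWithin_le_nhds
      have hu : Tendsto (fun x : ℝ => (1 + x) * Real.exp (-x)) (nhdsWithin 0 (Ioi 0)) (nhds 1) := by
        have : ContinuousAt (fun x : ℝ => (1 + x) * Real.exp (-x)) 0 := by fun_prop
        have h := this.tendsto
        simp only [neg_zero, Real.exp_zero, add_zero, mul_one] at h
        exact h.mono_left nhdsWithin_le_nhds
      refine tendsto_of_tendsto_of_tendsto_of_le_of_le' hl hu ?_ ?_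
      · filter_upwards [self_mem_nhdsWithin] with x hx using exp_neg_le_mul_coshMoment_one hx
      · filter_upwards [self_mem_nhdsWithin] with x hx using mul_coshMoment_one_le hx
    have hcosh : Tendsto (fun t : ℝ => 2 * z * Real.cosh t) (nhdsWithin 0 (Ioi 0)) (nhds (2 * z)) := by
      have : ContinuousAt (fun t : ℝ => 2 * z * Real.cosh t) 0 := by fun_prop
      have h := this.tendsto
      simp only [Real.cosh_zero, mul_one] at h
      exact h.mono_left nhdsWithin_le_nhds
    have hexp : Tendsto e (nhdsWithin 0 (Ioi 0)) (nhds 1) := by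
      have := (hed 0).continuousAt.tendsto
      simp only [he, mul_zero, Real.exp_zero] at this
      exact this.mono_left nhdsWithin_le_nhds
    have h := (((hxK.comp hx0).mul hcosh).mul hexp).add
      ((((hxK1.comp hx0).neg).const_mul (2 * ν)).mul hexp)
    rw [show 0 * (2 * z) * 1 + 2 * ν * -1 * 1 = -2 * ν by ring] at h
    exact h
  have hinf : Tendsto F atTop (nhds 0) := by
    set b : ℝ := 2 * |ν| + 1 with hb
    have hlim : Tendsto (fun t : ℝ => (16384 * z + 2 * |ν| * 4096) *
        (Real.exp ((b + 1) ^ 2 / (2 * z)) * Real.exp (-t))) atTop (nhds 0) := by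
      have := ((Real.tendsto_exp_neg_atTop_nhds_zero).const_mul
        (Real.exp ((b + 1) ^ 2 / (2 * z)))).const_mul (16384 * z + 2 * |ν| * 4096)
      rwa [mul_zero, mul_zero] at this
    refine squeeze_zero_norm' ?_ hlim
    filter_upwards [eventually_gt_atTop 0] with t ht
    have hs := Real.sinh_pos_iff.2 ht
    have hx : 0 < 2 * z * Real.sinh t := by positivity
    have hexp : Real.exp (-(2 * z * Real.sinh t) / 2) * (Real.exp t * e t)
        ≤ Real.exp ((b + 1) ^ 2 / (2 * z)) * Real.exp (-t) := by
      refine le_trans ?_ (exp_linear_sub_sq_le hz b t)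
      simp only [he]
      rw [← Real.exp_add, ← Real.exp_add]
      apply Real.exp_le_exp.2
      have h3 := mul_le_mul_of_nonneg_left (sq_half_le_sinh ht.le) hz.le
      have h4 : -ν * t ≤ |ν| * t := mul_le_mul_of_nonneg_right (neg_le_abs ν) ht.le
      simp only [hb]
      linarith
    set x := 2 * z * Real.sinh t
    have hp4 := one_add_pow_four_le hx
    have hm : x * coshMoment 1 x ≤ 4096 * Real.exp (-x / 2) := by
      refine (mul_coshMoment_one_le hx).trans (le_trans ?_ hp4)
      gcongr
      exact le_self_pow₀ (by linarith) (by norm_num)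
    have hm0 : 0 ≤ x * coshMoment 1 x := mul_nonneg hx.le (coshMoment_nonneg 1 x)
    have hk0 : K0 x ≤ coshMoment 1 x := by
      rw [← coshMoment_zero]
      refine setIntegral_mono_on (integrableOn_cosh_pow_mul_exp hx 0)
        (integrableOn_cosh_pow_mul_exp hx 1) measurableSet_Ioi fun s _ => ?_
      gcongr
      · exact Real.one_le_cosh s
      · norm_num
    have hk : x * K0 x ≤ 4096 * Real.exp (-x / 2) :=
      (mul_le_mul_of_nonneg_left hk0 hx.le).trans hm
    have hk1 : 0 ≤ x * K0 x := mul_nonneg hx.le (K0_nonneg x)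
    have het : 0 < e t := Real.exp_pos _
    have hct := cosh_le_exp_of_nonneg ht.le
    have h1e : 1 ≤ Real.exp t := Real.one_le_exp ht.le
    calc ‖F t‖ ≤ x * K0 x * (2 * z * Real.cosh t) * e t + 2 * |ν| * (x * coshMoment 1 x) * e t := by
          refine (norm_add_le _ _).trans (le_of_eq ?_)
          congr 1
          · exact Real.norm_of_nonneg (mul_nonneg (mul_nonneg hk1 (by positivity)) het.le)
          · rw [norm_mul, norm_mul, norm_mul, Real.norm_of_nonneg het.le]
            simp only [eulerK0, Real.norm_eq_abs, abs_neg, abs_two]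
            rw [abs_of_nonneg hm0]
      _ ≤ 4096 * Real.exp (-x / 2) * (2 * z * Real.exp t) * e t
          + 2 * |ν| * (4096 * Real.exp (-x / 2)) * e t * Real.exp t := by
          have hpos : 0 ≤ 2 * |ν| * (4096 * Real.exp (-x / 2)) * e t := by positivity
          have e1 : x * K0 x * (2 * z * Real.cosh t) * e t
              ≤ 4096 * Real.exp (-x / 2) * (2 * z * Real.exp t) * e t := by gcongr
          have e2 : 2 * |ν| * (x * coshMoment 1 x) * e t
              ≤ 2 * |ν| * (4096 * Real.exp (-x / 2)) * e t := by gcongr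
          nlinarith
      _ = (8192 * z + 2 * |ν| * 4096) * (Real.exp (-x / 2) * (Real.exp t * e t)) := by ring
      _ ≤ (16384 * z + 2 * |ν| * 4096) * (Real.exp ((b + 1) ^ 2 / (2 * z)) * Real.exp (-t)) := by
          gcongr
          norm_num
  have hmain := integral_Ioi_of_hasDerivAt_of_tendsto (a := (0:ℝ)) (m := 0)
    (f := Function.update F 0 (-2 * ν)) (f' := F')
    (by
      rw [continuousWithinAt_update_same, Ici_sdiff_left]
      exact hzero)
    (fun t ht => (hderiv t ht).congr_of_eventuallyEq (by
      filter_upwards [Ioi_mem_nhds ht] with s hs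
      exact Function.update_of_ne (ne_of_gt hs) _ _)) hi'
    (hinf.congr' (by
      filter_upwards [eventually_gt_atTop 0] with s hs
      exact (Function.update_of_ne (ne_of_gt hs) _ _).symm))
  rw [Function.update_self] at hmain
  have hsplit : ∫ t in Ioi (0:ℝ), F' t = nicholson 3 e z
      + 4 * z ^ 2 * (nicholson 1 e z + nicholson 0 e z) - 4 * ν ^ 2 * nicholson 1 e z := by
    simp only [hF', nicholson]
    rw [MeasureTheory.integral_sub (by exact i3.add ((i1.add i0).const_mul _)) (by exact i1.const_mul _),
      MeasureTheory.integral_add (by exact i3) (by exact (i1.add i0).const_mul _),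
      MeasureTheory.integral_const_mul, MeasureTheory.integral_const_mul,
      MeasureTheory.integral_add (by exact i1) (by exact i0)]
  rw [hsplit] at hmain
  linarith

lemma integral_inv_cosh_add {a : ℝ} (h1 : -1 < a) (h2 : a < 1) :
    IntegrableOn (fun t => 1 / (Real.cosh t + a)) (Ioi 0) ∧
      ∫ t in Ioi (0:ℝ), 1 / (Real.cosh t + a) = Real.arccos a / √(1 - a ^ 2) := by
  have hd0 : 0 < 1 - a ^ 2 := by nlinarith
  have hpos : ∀ t, 0 < Real.cosh t + a := fun t => by linarith [Real.one_le_cosh t]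
  set y : ℝ → ℝ := fun t => (1 + a * Real.cosh t) / (Real.cosh t + a) with hy
  have hyc : Continuous y :=
    Continuous.div (by fun_prop) (by fun_prop) fun t => (hpos t).ne'
  have hcont : Continuous fun t => Real.arccos (y t) / √(1 - a ^ 2) :=
    (Real.continuous_arccos.comp hyc).div_const _
  have hderiv : ∀ t ∈ Ioi (0:ℝ), HasDerivAt (fun t => Real.arccos (y t) / √(1 - a ^ 2))
      (1 / (Real.cosh t + a)) t := by
    intro t ht
    have hs := Real.sinh_pos_iff.2 ht
    have hp := hpos t
    have hc := Real.cosh_sq t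
    have hsq : 1 - y t ^ 2 = (Real.sinh t * √(1 - a ^ 2) / (Real.cosh t + a)) ^ 2 := by
      simp only [hy]
      rw [div_pow, div_pow, mul_pow, Real.sq_sqrt hd0.le]
      field_simp
      rw [show Real.sinh t ^ 2 = Real.cosh t ^ 2 - 1 by linarith]
      ring
    have hr : 0 < √(1 - a ^ 2) := Real.sqrt_pos.2 hd0
    have hne : 0 < 1 - y t ^ 2 := by rw [hsq]; positivity
    have hyd : HasDerivAt y (-(Real.sinh t * (1 - a ^ 2)) / (Real.cosh t + a) ^ 2) t := by
      have hn : HasDerivAt (fun t => 1 + a * Real.cosh t) (a * Real.sinh t) t :=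
        ((Real.hasDerivAt_cosh t).const_mul a).const_add 1
      have hdn : HasDerivAt (fun t => Real.cosh t + a) (Real.sinh t) t :=
        (Real.hasDerivAt_cosh t).add_const a
      refine (hn.div hdn hp.ne').congr_deriv ?_
      congr 1; ring
    have hA := Real.hasDerivAt_arccos (x := y t) (by rintro h; rw [h] at hne; norm_num at hne)
      (by rintro h; rw [h] at hne; norm_num at hne)
    refine ((HasDerivAt.comp t hA hyd).div_const _).congr_deriv ?_
    rw [hsq, Real.sqrt_sq (by positivity)]
    have := Real.sq_sqrt hd0.le
    field_simp
    linarith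
  have hlim : Tendsto (fun t => Real.arccos (y t) / √(1 - a ^ 2)) atTop
      (nhds (Real.arccos a / √(1 - a ^ 2))) := by
    refine ((Real.continuous_arccos.tendsto a).comp ?_).div_const _
    have hc : Tendsto (fun t => Real.cosh t + a) atTop atTop := by
      refine tendsto_atTop_add_const_right _ _ ?_
      refine tendsto_atTop_mono' atTop (f₁ := fun t : ℝ => t) ?_ tendsto_id
      filter_upwards [eventually_ge_atTop 0] with t ht
      exact (Real.self_le_sinh_iff.2 ht).trans (Real.sinh_lt_cosh t).le
    have h3 := (tendsto_inv_atTop_zero.comp hc).const_mul (1 - a ^ 2) |>.const_add a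
    rw [mul_zero, add_zero] at h3
    refine h3.congr fun t => ?_
    simp only [hy, Function.comp_apply]
    have := (hpos t).ne'
    field_simp
    ring
  have hnn : ∀ t ∈ Ioi (0:ℝ), 0 ≤ 1 / (Real.cosh t + a) := fun t _ =>
    div_nonneg zero_le_one (hpos t).le
  refine ⟨integrableOn_Ioi_deriv_of_nonneg hcont.continuousWithinAt hderiv hnn hlim, ?_⟩
  rw [integral_Ioi_of_hasDerivAt_of_nonneg hcont.continuousWithinAt hderiv hnn hlim]
  have : y 0 = 1 := by
    simp only [hy, Real.cosh_zero, mul_one]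
    exact div_self (by linarith)
  simp [this]

/-- The Laplace transform of `K0`. -/
lemma laplace_K0 {a : ℝ} (h1 : -1 < a) (h2 : a < 1) :
    IntegrableOn (fun r => K0 r * Real.exp (-a * r)) (Ioi 0) ∧
      ∫ r in Ioi (0:ℝ), K0 r * Real.exp (-a * r) = Real.arccos a / √(1 - a ^ 2) := by
  obtain ⟨hi, he⟩ := integral_inv_cosh_add h1 h2
  have hpos : ∀ t, 0 < Real.cosh t + a := fun t => by linarith [Real.one_le_cosh t]
  have hexp : ∀ t : ℝ, ∫ r in Ioi (0:ℝ), Real.exp (-(Real.cosh t + a) * r)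
      = 1 / (Real.cosh t + a) := by
    intro t
    have h : -(Real.cosh t + a) < 0 := by linarith [hpos t]
    rw [integral_exp_mul_Ioi h, mul_zero, Real.exp_zero, neg_div_neg_eq]
  have hint : Integrable (Function.uncurry fun r t : ℝ => Real.exp (-(Real.cosh t + a) * r))
      ((volume.restrict (Ioi 0)).prod (volume.restrict (Ioi 0))) := by
    rw [integrable_prod_iff' (by
      exact (by fun_prop : Continuous (Function.uncurry fun r t : ℝ =>
        Real.exp (-(Real.cosh t + a) * r))).aestronglyMeasurable)]
    refine ⟨Eventually.of_forall fun t => ?_, ?_⟩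
    · have h : -(Real.cosh t + a) < 0 := by linarith [hpos t]
      exact integrableOn_exp_mul_Ioi h 0
    · simp only [Function.uncurry, Real.norm_eq_abs, Real.abs_exp]
      simp_rw [hexp]
      exact hi
  have hK : ∀ r : ℝ, ∫ t in Ioi (0:ℝ), Real.exp (-(Real.cosh t + a) * r)
      = K0 r * Real.exp (-a * r) := by
    intro r
    unfold K0
    rw [← MeasureTheory.integral_mul_const]
    congr 1; ext t
    rw [← Real.exp_add]; congr 1; ring
  constructor
  · have := hint.integral_prod_left
    simp only [Function.uncurry] at this
    simp_rw [hK] at this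
    exact this
  · have := integral_integral_swap hint
    simp_rw [hK, hexp] at this
    rw [this, he]

lemma image_sinh_scale {z : ℝ} (hz : 0 < z) :
    (fun t => 2 * z * Real.sinh t) '' Ioi 0 = Ioi 0 := by
  ext r
  constructor
  · rintro ⟨t, ht, rfl⟩
    have := Real.sinh_pos_iff.2 ht
    exact mem_Ioi.2 (by positivity)
  · intro hr
    have hr0 : 0 < r := hr
    refine ⟨Real.arsinh (r / (2 * z)), ?_, ?_⟩
    · exact mem_Ioi.2 (Real.arsinh_pos_iff.2 (by positivity))
    · simp only [Real.sinh_arsinh]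
      field_simp

lemma integral_sinh_scale {z : ℝ} (hz : 0 < z) {G : ℝ → ℝ} (hG : IntegrableOn G (Ioi 0)) :
    IntegrableOn (fun t => G (2 * z * Real.sinh t) * Real.cosh t) (Ioi 0) ∧
      ∫ t in Ioi (0:ℝ), G (2 * z * Real.sinh t) * Real.cosh t
        = (∫ r in Ioi (0:ℝ), G r) / (2 * z) := by
  have hd : ∀ t ∈ Ioi (0:ℝ), HasDerivWithinAt (fun t => 2 * z * Real.sinh t)
      (2 * z * Real.cosh t) (Ioi 0) t := fun t _ => (hasDerivAt_sinh_scale z t).hasDerivWithinAt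
  have hinj : InjOn (fun t => 2 * z * Real.sinh t) (Ioi 0) := by
    intro s _ t _ hst
    exact Real.sinh_injective (mul_left_cancel₀ (by positivity) hst)
  have h1 := integrableOn_image_iff_integrableOn_abs_deriv_smul measurableSet_Ioi hd hinj G
  have h2 := integral_image_eq_integral_abs_deriv_smul measurableSet_Ioi hd hinj G
  rw [image_sinh_scale hz] at h1 h2
  have h3 : ∀ t, |2 * z * Real.cosh t| • G (2 * z * Real.sinh t)
      = 2 * z * (G (2 * z * Real.sinh t) * Real.cosh t) := by
    intro t
    rw [abs_of_pos (by positivity), smul_eq_mul]; ring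
  simp_rw [h3] at h1 h2
  constructor
  · have := (h1.1 hG).const_mul (2 * z)⁻¹
    refine this.congr (Eventually.of_forall fun t => ?_)
    simp only
    field_simp
  · rw [h2, MeasureTheory.integral_const_mul]
    field_simp

lemma cosh_sub_one_le_sinh_sq (t : ℝ) : Real.cosh t - 1 ≤ Real.sinh t ^ 2 := by
  have := Real.cosh_sq t
  nlinarith [Real.one_le_cosh t]

lemma sinh_sub_le_sinh_cube {t : ℝ} (ht : 0 ≤ t) : Real.sinh t - t ≤ Real.sinh t ^ 3 := by
  have hd : ∀ s : ℝ, HasDerivAt (fun s => Real.sinh s ^ 3 + s - Real.sinh s)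
      (3 * Real.sinh s ^ 2 * Real.cosh s + 1 - Real.cosh s) s := by
    intro s
    refine ((((Real.hasDerivAt_sinh s).pow 3).add (hasDerivAt_id s)).sub
      (Real.hasDerivAt_sinh s)).congr_deriv ?_
    norm_num
  have hm : Monotone (fun s => Real.sinh s ^ 3 + s - Real.sinh s) := by
    refine monotone_of_hasDerivAt_nonneg hd fun s => ?_
    have h1 := cosh_sub_one_le_sinh_sq s
    have h2 := Real.one_le_cosh s
    have h3 : Real.sinh s ^ 2 * 1 ≤ Real.sinh s ^ 2 * Real.cosh s := by gcongr
    simp only [Pi.zero_apply]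
    nlinarith [sq_nonneg (Real.sinh s)]
  have := hm ht
  simp at this
  linarith

lemma abs_exp_sub_exp_le {a b m : ℝ} (ha : a ≤ m) (hb : b ≤ m) :
    |Real.exp a - Real.exp b| ≤ |a - b| * Real.exp m := by
  wlog h : b ≤ a generalizing a b
  · rw [abs_sub_comm, abs_sub_comm a b]
    exact this hb ha (le_of_not_ge h)
  rw [abs_of_nonneg (sub_nonneg.2 (Real.exp_le_exp.2 h)), abs_of_nonneg (sub_nonneg.2 h)]
  have h1 := Real.add_one_le_exp (b - a)
  have h2 : Real.exp b = Real.exp a * Real.exp (b - a) := by rw [← Real.exp_add]; congr 1; ring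
  have h3 : Real.exp a ≤ Real.exp m := Real.exp_le_exp.2 ha
  rw [h2]
  have h4 := Real.exp_pos a
  nlinarith

lemma abs_exp_sub_exp_sinh_le (μ : ℝ) {t : ℝ} (ht : 0 ≤ t) :
    |Real.exp (-2 * μ * t) - Real.exp (-2 * μ * Real.sinh t) * Real.cosh t|
      ≤ (Real.sinh t ^ 2 + 2 * |μ| * Real.sinh t ^ 3) * Real.exp (2 * |μ| * Real.sinh t)
        * Real.cosh t := by
  set s := Real.sinh t with hs
  have hs0 : t ≤ s := Real.self_le_sinh_iff.2 ht
  have h3 := sinh_sub_le_sinh_cube ht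
  have hc := cosh_sub_one_le_sinh_sq t
  have hc1 := Real.one_le_cosh t
  have ha : -2 * μ * t ≤ 2 * |μ| * s := by
    have : -μ * t ≤ |μ| * t := mul_le_mul_of_nonneg_right (neg_le_abs μ) ht
    have : |μ| * t ≤ |μ| * s := mul_le_mul_of_nonneg_left hs0 (abs_nonneg μ)
    linarith
  have hb : -2 * μ * s ≤ 2 * |μ| * s := by
    have : -μ * s ≤ |μ| * s := mul_le_mul_of_nonneg_right (neg_le_abs μ) (ht.trans hs0)
    linarith
  have hE := Real.exp_pos (2 * |μ| * s)
  have hd := abs_exp_sub_exp_le ha hb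
  have habs : |-2 * μ * t - -2 * μ * s| = 2 * |μ| * (s - t) := by
    rw [show -2 * μ * t - -2 * μ * s = 2 * μ * (s - t) by ring, abs_mul, abs_mul, abs_two,
      abs_of_nonneg (sub_nonneg.2 hs0)]
  rw [habs] at hd
  have hb' : Real.exp (-2 * μ * s) ≤ Real.exp (2 * |μ| * s) := Real.exp_le_exp.2 hb
  have hfirst : |Real.exp (-2 * μ * t) - Real.exp (-2 * μ * s) * Real.cosh t|
      ≤ 2 * |μ| * (s - t) * Real.exp (2 * |μ| * s)
        + Real.exp (2 * |μ| * s) * (Real.cosh t - 1) := by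
    rw [show Real.exp (-2 * μ * t) - Real.exp (-2 * μ * s) * Real.cosh t
      = (Real.exp (-2 * μ * t) - Real.exp (-2 * μ * s))
        - Real.exp (-2 * μ * s) * (Real.cosh t - 1) by ring]
    refine (abs_sub _ _).trans (add_le_add hd ?_)
    rw [abs_mul, Real.abs_exp, abs_of_nonneg (by linarith)]
    exact mul_le_mul_of_nonneg_right hb' (by linarith)
  refine hfirst.trans ?_
  have h4 : 2 * |μ| * (s - t) ≤ 2 * |μ| * s ^ 3 := by gcongr
  have h5 : 2 * |μ| * (s - t) * Real.exp (2 * |μ| * s) + Real.exp (2 * |μ| * s) * (Real.cosh t - 1)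
      ≤ (s ^ 2 + 2 * |μ| * s ^ 3) * Real.exp (2 * |μ| * s) := by
    nlinarith
  refine h5.trans (le_mul_of_one_le_right ?_ hc1)
  have : 0 ≤ s := ht.trans hs0
  positivity

lemma integrableOn_K0_mul_pow_mul_exp {q : ℝ} (hq : q < 1) (n : ℕ) :
    IntegrableOn (fun r => K0 r * (r ^ n * Real.exp (q * r))) (Ioi 0) := by
  have hn : (-1 : ℝ) < (n : ℝ) - 1 / 2 := by
    have : (0:ℝ) ≤ n := n.cast_nonneg
    linarith
  have h := (integrableOn_rpow_mul_exp_neg_mul_rpow hn one_pos (sub_pos.2 hq)).const_mul 2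
  simp only [Real.rpow_one] at h
  refine Integrable.mono' h ?_ ?_
  · refine ContinuousOn.aestronglyMeasurable ?_ measurableSet_Ioi
    exact (continuousOn_eulerK0 0).mul (by fun_prop)
  · filter_upwards [ae_restrict_mem measurableSet_Ioi] with r hr
    have hr0 : 0 < r := hr
    rw [Real.norm_of_nonneg (mul_nonneg (K0_nonneg r) (by positivity))]
    have h1 : r ^ ((n : ℝ) - 1 / 2) = r ^ n * r ^ (-(1 / 2) : ℝ) := by
      rw [← Real.rpow_natCast, ← Real.rpow_add hr0]; congr 1
    have h2 : Real.exp (-(1 - q) * r) = Real.exp (-r) * Real.exp (q * r) := by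
      rw [← Real.exp_add]; congr 1; ring
    rw [h1, h2]
    calc _ ≤ (2 * r ^ (-(1 / 2) : ℝ) * Real.exp (-r)) * (r ^ n * Real.exp (q * r)) := by
          gcongr; exact K0_le hr0
      _ = _ := by ring

/-- Uniform approximation of the one-sided Nicholson integral away from the turning point. -/
lemma nicholson_approx {q : ℝ} (hq : q < 1) :
    ∃ K : ℝ, 0 ≤ K ∧ ∀ z μ : ℝ, 0 < z → |μ| ≤ q * z →
      |z * nicholson 0 (fun t => Real.exp (-2 * μ * t)) z
        - Real.arccos (μ / z) / √(1 - (μ / z) ^ 2) / 2| ≤ K / z ^ 2 := by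
  set G : ℝ → ℝ := fun r => K0 r * (r ^ 2 * Real.exp (q * r)) + K0 r * (r ^ 3 * Real.exp (q * r))
    with hG
  have hGi : IntegrableOn G (Ioi 0) :=
    (integrableOn_K0_mul_pow_mul_exp hq 2).add (integrableOn_K0_mul_pow_mul_exp hq 3)
  have hG0 : 0 ≤ ∫ r in Ioi (0:ℝ), G r := setIntegral_nonneg measurableSet_Ioi fun r hr => by
    have hr0 : 0 < r := hr
    have := K0_nonneg r
    positivity
  refine ⟨(∫ r in Ioi (0:ℝ), G r) / 8, by positivity, fun z μ hz hμ => ?_⟩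
  have ha : |μ / z| < 1 := by
    rw [abs_div, abs_of_pos hz, div_lt_one hz]
    nlinarith
  obtain ⟨ha1, ha2⟩ := abs_lt.1 ha
  obtain ⟨hLi, hL⟩ := laplace_K0 ha1 ha2
  obtain ⟨hSi, hS⟩ := integral_sinh_scale hz hLi
  obtain ⟨hTi, hT⟩ := integral_sinh_scale hz hGi
  rw [hL] at hS
  have hNi := integrableOn_nicholson 0 (expWeight_exp μ) hz
  have hdiff : |nicholson 0 (fun t => Real.exp (-2 * μ * t)) z
      - Real.arccos (μ / z) / √(1 - (μ / z) ^ 2) / (2 * z)|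
      ≤ ∫ t in Ioi (0:ℝ), 1 / (4 * z ^ 2) * (G (2 * z * Real.sinh t) * Real.cosh t) := by
    rw [← hS]
    unfold nicholson
    rw [← MeasureTheory.integral_sub hNi hSi, ← Real.norm_eq_abs]
    refine norm_integral_le_of_norm_le (hTi.const_mul _) ?_
    filter_upwards [ae_restrict_mem measurableSet_Ioi] with t ht
    have ht0 : 0 < t := ht
    have hs := Real.sinh_pos_iff.2 ht0
    have hb := abs_exp_sub_exp_sinh_le μ ht0.le
    have hk := K0_nonneg (2 * z * Real.sinh t)
    simp only [eulerK0, hG]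
    rw [show -(μ / z) * (2 * z * Real.sinh t) = -2 * μ * Real.sinh t by field_simp]
    rw [show K0 (2 * z * Real.sinh t) * Real.exp (-2 * μ * t)
        - K0 (2 * z * Real.sinh t) * Real.exp (-2 * μ * Real.sinh t) * Real.cosh t
      = K0 (2 * z * Real.sinh t) * (Real.exp (-2 * μ * t)
        - Real.exp (-2 * μ * Real.sinh t) * Real.cosh t) by ring, norm_mul,
      Real.norm_of_nonneg hk, Real.norm_eq_abs]
    have hexp : Real.exp (2 * |μ| * Real.sinh t) ≤ Real.exp (q * (2 * z * Real.sinh t)) := by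
      apply Real.exp_le_exp.2
      nlinarith
    have hpol : Real.sinh t ^ 2 + 2 * |μ| * Real.sinh t ^ 3 ≤
        1 / (4 * z ^ 2) * ((2 * z * Real.sinh t) ^ 2 + (2 * z * Real.sinh t) ^ 3) := by
      rw [show 1 / (4 * z ^ 2) * ((2 * z * Real.sinh t) ^ 2 + (2 * z * Real.sinh t) ^ 3)
        = Real.sinh t ^ 2 + 2 * z * Real.sinh t ^ 3 by field_simp; ring]
      have : |μ| ≤ z := hμ.trans (by nlinarith)
      gcongr
    calc _ ≤ K0 (2 * z * Real.sinh t) * ((Real.sinh t ^ 2 + 2 * |μ| * Real.sinh t ^ 3)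
          * Real.exp (2 * |μ| * Real.sinh t) * Real.cosh t) := by gcongr
      _ ≤ K0 (2 * z * Real.sinh t) * ((1 / (4 * z ^ 2) * ((2 * z * Real.sinh t) ^ 2
          + (2 * z * Real.sinh t) ^ 3)) * Real.exp (q * (2 * z * Real.sinh t)) * Real.cosh t) := by
          gcongr
      _ = _ := by ring
  rw [MeasureTheory.integral_const_mul, hT] at hdiff
  have h2 := mul_le_mul_of_nonneg_left hdiff hz.le
  rw [← abs_of_pos hz, ← abs_mul, abs_of_pos hz] at h2
  calc _ = |z * (nicholson 0 (fun t => Real.exp (-2 * μ * t)) z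
        - Real.arccos (μ / z) / √(1 - (μ / z) ^ 2) / (2 * z))| := by
        congr 1; field_simp
    _ ≤ _ := h2
    _ = _ := by field_simp; ring

/-- The one-sided Nicholson integral of order `ν` and its Euler derivatives in `z`. -/
noncomputable def expNicholson (j : ℕ) (ν z : ℝ) : ℝ :=
  nicholson j (fun t => Real.exp (-2 * ν * t)) z

/-- The order derivative of `expNicholson`. -/
noncomputable def expNicholsonOrder (j : ℕ) (ν z : ℝ) : ℝ :=
  nicholson j (fun t => -2 * t * Real.exp (-2 * ν * t)) z

/-- Nicholson's integral with the even weight `cosh (2 * ν * t)` and its Euler derivatives. -/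
noncomputable def coshNicholson (j : ℕ) (ν z : ℝ) : ℝ :=
  (expNicholson j ν z + expNicholson j (-ν) z) / 2

/-- The order derivative of `coshNicholson`. -/
noncomputable def coshNicholsonOrder (j : ℕ) (ν z : ℝ) : ℝ :=
  (expNicholsonOrder j ν z - expNicholsonOrder j (-ν) z) / 2

lemma hasDerivAt_expNicholson {j : ℕ} (hj : j < 3) (ν : ℝ) {z : ℝ} (hz : 0 < z) :
    HasDerivAt (expNicholson j ν) (expNicholson (j + 1) ν z / z) z :=
  hasDerivAt_nicholson hj (expWeight_exp ν) hz

lemma hasDerivAt_coshNicholson {j : ℕ} (hj : j < 3) (ν : ℝ) {z : ℝ} (hz : 0 < z) :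
    HasDerivAt (coshNicholson j ν) (coshNicholson (j + 1) ν z / z) z := by
  refine (((hasDerivAt_expNicholson hj ν hz).add
    (hasDerivAt_expNicholson hj (-ν) hz)).div_const 2).congr_deriv ?_
  unfold coshNicholson
  ring

lemma hasDerivAt_coshNicholsonOrder {j : ℕ} (hj : j < 3) (ν : ℝ) {z : ℝ} (hz : 0 < z) :
    HasDerivAt (coshNicholsonOrder j ν) (coshNicholsonOrder (j + 1) ν z / z) z := by
  refine (((hasDerivAt_nicholson hj (expWeight_mul_exp ν) hz).sub
    (hasDerivAt_nicholson hj (expWeight_mul_exp (-ν)) hz)).div_const 2).congr_deriv ?_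
  unfold coshNicholsonOrder expNicholsonOrder
  ring

lemma hasDerivAt_expNicholson_order (j : ℕ) (ν : ℝ) {z : ℝ} (hz : 0 < z) :
    HasDerivAt (fun μ => expNicholson j μ z) (expNicholsonOrder j ν z) ν :=
  hasDerivAt_nicholson_order j hz ν

lemma hasDerivAt_coshNicholson_order (j : ℕ) (ν : ℝ) {z : ℝ} (hz : 0 < z) :
    HasDerivAt (fun μ => coshNicholson j μ z) (coshNicholsonOrder j ν z) ν := by
  have h2 : HasDerivAt (fun μ => expNicholson j (-μ) z) (expNicholsonOrder j (-ν) z * -1) ν :=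
    HasDerivAt.comp ν (hasDerivAt_expNicholson_order j (-ν) hz) (hasDerivAt_neg ν)
  refine (((hasDerivAt_expNicholson_order j ν hz).add h2).div_const 2).congr_deriv ?_
  unfold coshNicholsonOrder
  ring

lemma expNicholson_three (ν : ℝ) {z : ℝ} (hz : 0 < z) :
    expNicholson 3 ν z = 4 * ν ^ 2 * expNicholson 1 ν z + 2 * ν
      - 4 * z ^ 2 * (expNicholson 1 ν z + expNicholson 0 ν z) := by
  have := nicholson_third_order ν hz
  unfold expNicholson
  linarith

lemma coshNicholson_three (ν : ℝ) {z : ℝ} (hz : 0 < z) :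
    coshNicholson 3 ν z = 4 * ν ^ 2 * coshNicholson 1 ν z
      - 4 * z ^ 2 * (coshNicholson 1 ν z + coshNicholson 0 ν z) := by
  unfold coshNicholson
  rw [expNicholson_three ν hz, expNicholson_three (-ν) hz]
  ring

lemma eq_of_deriv_zero_of_tendsto {f : ℝ → ℝ} {l : ℝ} (hf : ∀ z, 0 < z → HasDerivAt f 0 z)
    (hl : Tendsto f atTop (nhds l)) {z : ℝ} (hz : 0 < z) : f z = l := by
  have hconst : ∀ y, 0 < y → f y = f z := fun y hy =>
    (convex_Ioi (0:ℝ)).is_const_of_fderivWithin_eq_zero (𝕜 := ℝ)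
      (fun x hx => (hf x hx).differentiableAt.differentiableWithinAt)
      (fun x hx => by
        rw [fderivWithin_of_isOpen isOpen_Ioi hx]
        ext
        simp [(hf x hx).deriv]) hy hz
  refine tendsto_nhds_unique ?_ hl
  refine tendsto_const_nhds.congr' ?_
  filter_upwards [eventually_gt_atTop 0] with y hy
  exact (hconst y hy).symm

lemma tendsto_zero_of_abs_le_div_pow {f : ℝ → ℝ} {K : ℝ} {n : ℕ} (hn : n ≠ 0)
    (h : ∀ᶠ z in atTop, |f z| ≤ K / z ^ n) : Tendsto f atTop (nhds 0) := by
  refine squeeze_zero_norm' h ?_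
  exact tendsto_const_nhds.div_atTop (tendsto_pow_atTop hn)

lemma tendsto_expNicholson (j : ℕ) (ν : ℝ) :
    Tendsto (expNicholson j ν) atTop (nhds 0) := by
  obtain ⟨K, hK⟩ := nicholson_abs_le j 0 ν
  refine tendsto_zero_of_abs_le_div_pow (K := K) (n := 1) one_ne_zero ?_
  filter_upwards [eventually_gt_atTop 0, eventually_ge_atTop (4 * |ν|)] with z hz hz'
  exact hK z hz hz' _ (exp_order_abs_le ν)

lemma tendsto_mul_expNicholsonOrder (j : ℕ) (ν : ℝ) :
    Tendsto (fun z => z * expNicholsonOrder j ν z) atTop (nhds 0) := by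
  obtain ⟨K, hK⟩ := nicholson_abs_le j 1 ν
  refine tendsto_zero_of_abs_le_div_pow (K := K) (n := 1) one_ne_zero ?_
  filter_upwards [eventually_gt_atTop 0, eventually_ge_atTop (4 * |ν|)] with z hz hz'
  rw [abs_mul, abs_of_pos hz]
  calc _ ≤ z * (K / z ^ (1 + 1)) := by
        gcongr; exact hK z hz hz' _ (mul_exp_order_abs_le ν)
    _ = _ := by field_simp; ring

lemma tendsto_mul_expNicholson_zero (ν : ℝ) :
    Tendsto (fun z => z * expNicholson 0 ν z) atTop (nhds (π / 4)) := by
  obtain ⟨K, hK0, hK⟩ := nicholson_approx (q := 1 / 2) (by norm_num)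
  have h1 : Tendsto (fun z => z * expNicholson 0 ν z
      - Real.arccos (ν / z) / √(1 - (ν / z) ^ 2) / 2) atTop (nhds 0) := by
    refine tendsto_zero_of_abs_le_div_pow (K := K) (n := 2) two_ne_zero ?_
    filter_upwards [eventually_gt_atTop 0, eventually_ge_atTop (2 * |ν|)] with z hz hz'
    exact hK z ν hz (by linarith)
  have h2 : Tendsto (fun z : ℝ => ν / z) atTop (nhds 0) := tendsto_const_nhds.div_atTop tendsto_id
  have h3 : ContinuousAt (fun a : ℝ => Real.arccos a / √(1 - a ^ 2) / 2) 0 := by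
    refine ContinuousAt.div_const (ContinuousAt.div Real.continuous_arccos.continuousAt ?_ ?_) 2
    · fun_prop
    · simp
  have h4 := h1.add (h3.tendsto.comp h2)
  refine Tendsto.congr (fun z => ?_) (by
    convert h4 using 2
    simp
    ring)
  simp

lemma tendsto_coshNicholson (j : ℕ) (ν : ℝ) :
    Tendsto (coshNicholson j ν) atTop (nhds 0) := by
  have := ((tendsto_expNicholson j ν).add (tendsto_expNicholson j (-ν))).div_const 2
  have h : Tendsto (coshNicholson j ν) atTop (nhds ((0 + 0) / 2)) := this
  simpa using h

lemma tendsto_mul_coshNicholson_zero (ν : ℝ) :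
    Tendsto (fun z => z * coshNicholson 0 ν z) atTop (nhds (π / 4)) := by
  have := ((tendsto_mul_expNicholson_zero ν).add (tendsto_mul_expNicholson_zero (-ν))).div_const 2
  convert this using 2
  · unfold coshNicholson; ring
  · ring

lemma tendsto_mul_coshNicholsonOrder (j : ℕ) (ν : ℝ) :
    Tendsto (fun z => z * coshNicholsonOrder j ν z) atTop (nhds 0) := by
  have := ((tendsto_mul_expNicholsonOrder j ν).sub
    (tendsto_mul_expNicholsonOrder j (-ν))).div_const 2
  convert this using 2
  · unfold coshNicholsonOrder; ring
  · simp

/-- The quadratic first integral of Nicholson's third order equation. -/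
lemma coshNicholson_first_integral (ν : ℝ) {z : ℝ} (hz : 0 < z) :
    2 * coshNicholson 0 ν z * coshNicholson 2 ν z - coshNicholson 1 ν z ^ 2
      + 4 * (z ^ 2 - ν ^ 2) * coshNicholson 0 ν z ^ 2 = π ^ 2 / 4 := by
  refine eq_of_deriv_zero_of_tendsto (f := fun z => 2 * coshNicholson 0 ν z * coshNicholson 2 ν z
    - coshNicholson 1 ν z ^ 2 + 4 * (z ^ 2 - ν ^ 2) * coshNicholson 0 ν z ^ 2) ?_ ?_ hz
  · intro z hz
    have h0 := hasDerivAt_coshNicholson (j := 0) (by norm_num) ν hz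
    have h1 := hasDerivAt_coshNicholson (j := 1) (by norm_num) ν hz
    have h2 := hasDerivAt_coshNicholson (j := 2) (by norm_num) ν hz
    have hp : HasDerivAt (fun z : ℝ => 4 * (z ^ 2 - ν ^ 2)) (4 * (2 * z)) z := by
      refine (((hasDerivAt_pow 2 z).sub_const (ν ^ 2)).const_mul 4).congr_deriv (by norm_num)
    refine ((((h0.const_mul 2).mul h2).sub (h1.pow 2)).add (hp.mul (h0.pow 2))).congr_deriv ?_
    simp only [zero_add, Nat.reduceAdd, Pi.pow_apply]
    rw [coshNicholson_three ν hz]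
    field_simp
    ring
  · have t0 := tendsto_coshNicholson 0 ν
    have t1 := tendsto_coshNicholson 1 ν
    have t2 := tendsto_coshNicholson 2 ν
    have tz := tendsto_mul_coshNicholson_zero ν
    have := ((((t0.const_mul 2).mul t2).sub (t1.pow 2)).add ((tz.pow 2).const_mul 4)).sub
      ((t0.pow 2).const_mul (4 * ν ^ 2))
    convert this using 2
    · ring
    · ring

lemma coshNicholson_zero_nonneg (ν z : ℝ) : 0 ≤ coshNicholson 0 ν z := by
  have h : ∀ μ, 0 ≤ expNicholson 0 μ z := fun μ =>
    MeasureTheory.integral_nonneg fun t => mul_nonneg (K0_nonneg _) (Real.exp_pos _).le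
  have h1 := h ν
  have h2 := h (-ν)
  unfold coshNicholson
  positivity

lemma coshNicholson_zero_pos (ν : ℝ) {z : ℝ} (hz : 0 < z) : 0 < coshNicholson 0 ν z := by
  refine (coshNicholson_zero_nonneg ν z).lt_of_ne fun h => ?_
  have := coshNicholson_first_integral ν hz
  rw [← h] at this
  have hpi := Real.pi_pos
  nlinarith [sq_nonneg (coshNicholson 1 ν z), sq_nonneg π]

lemma coshNicholsonOrder_first_integral (ν : ℝ) {z : ℝ} (hz : 0 < z) :
    coshNicholsonOrder 0 ν z * coshNicholson 2 ν z + coshNicholson 0 ν z * coshNicholsonOrder 2 ν z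
      - coshNicholson 1 ν z * coshNicholsonOrder 1 ν z
      + 4 * (z ^ 2 - ν ^ 2) * coshNicholson 0 ν z * coshNicholsonOrder 0 ν z
      = 4 * ν * coshNicholson 0 ν z ^ 2 := by
  have h0 := hasDerivAt_coshNicholson_order 0 ν hz
  have h1 := hasDerivAt_coshNicholson_order 1 ν hz
  have h2 := hasDerivAt_coshNicholson_order 2 ν hz
  have hp : HasDerivAt (fun μ : ℝ => 4 * (z ^ 2 - μ ^ 2)) (4 * (-(2 * ν))) ν := by
    refine (((hasDerivAt_pow 2 ν).const_sub (z ^ 2)).const_mul 4).congr_deriv (by norm_num)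
  have h := (((h0.const_mul 2).mul h2).sub (h1.pow 2)).add (hp.mul (h0.pow 2))
  have hc := h.congr_of_eventuallyEq (f₁ := fun _ => π ^ 2 / 4)
    (Eventually.of_forall fun μ => (coshNicholson_first_integral μ hz).symm)
  have := hc.unique (hasDerivAt_const ν (π ^ 2 / 4))
  norm_num at this
  linarith

/-- The order derivative of Nicholson's integral is a Wronskian of one-sided integrals. -/
lemma coshNicholsonOrder_zero_eq (ν : ℝ) {z : ℝ} (hz : 0 < z) :
    coshNicholsonOrder 0 ν z = expNicholson 0 (-ν) z * expNicholson 1 ν z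
      - expNicholson 0 ν z * expNicholson 1 (-ν) z := by
  set a : ℕ → ℝ → ℝ := fun j => expNicholson j ν with ha
  set b : ℕ → ℝ → ℝ := fun j => expNicholson j (-ν) with hb
  set C : ℕ → ℝ → ℝ := fun j => coshNicholson j ν with hC
  set P : ℕ → ℝ → ℝ := fun j => coshNicholsonOrder j ν with hP
  set E0 : ℝ → ℝ := fun z => P 0 z - (b 0 z * a 1 z - a 0 z * b 1 z) with hE0
  set E1 : ℝ → ℝ := fun z => P 1 z - (b 0 z * a 2 z - a 0 z * b 2 z) with hE1
  set E2 : ℝ → ℝ := fun z => P 2 z - (b 0 z * a 3 z - a 0 z * b 3 z + b 1 z * a 2 z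
    - a 1 z * b 2 z) with hE2
  have dC : ∀ j, j < 3 → ∀ z, 0 < z → HasDerivAt (C j) (C (j + 1) z / z) z :=
    fun j hj z hz => hasDerivAt_coshNicholson hj ν hz
  have da : ∀ j, j < 3 → ∀ z, 0 < z → HasDerivAt (a j) (a (j + 1) z / z) z :=
    fun j hj z hz => hasDerivAt_expNicholson hj ν hz
  have db : ∀ j, j < 3 → ∀ z, 0 < z → HasDerivAt (b j) (b (j + 1) z / z) z :=
    fun j hj z hz => hasDerivAt_expNicholson hj (-ν) hz
  have dP : ∀ j, j < 3 → ∀ z, 0 < z → HasDerivAt (P j) (P (j + 1) z / z) z :=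
    fun j hj z hz => hasDerivAt_coshNicholsonOrder hj ν hz
  have hCpos : ∀ z, 0 < z → C 0 z ≠ 0 := fun z hz => (coshNicholson_zero_pos ν hz).ne'
  have dE0 : ∀ z, 0 < z → HasDerivAt E0 (E1 z / z) z := by
    intro z hz
    refine ((dP 0 (by norm_num) z hz).sub (((db 0 (by norm_num) z hz).mul
      (da 1 (by norm_num) z hz)).sub ((da 0 (by norm_num) z hz).mul
      (db 1 (by norm_num) z hz)))).congr_deriv ?_
    simp only [zero_add, Nat.reduceAdd, hE1]
    ring
  have dE1 : ∀ z, 0 < z → HasDerivAt E1 (E2 z / z) z := by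
    intro z hz
    refine ((dP 1 (by norm_num) z hz).sub (((db 0 (by norm_num) z hz).mul
      (da 2 (by norm_num) z hz)).sub ((da 0 (by norm_num) z hz).mul
      (db 2 (by norm_num) z hz)))).congr_deriv ?_
    simp only [zero_add, Nat.reduceAdd, hE2]
    ring
  have hrel : ∀ z, 0 < z → E0 z * C 2 z + C 0 z * E2 z - C 1 z * E1 z
      + 4 * (z ^ 2 - ν ^ 2) * C 0 z * E0 z = 0 := by
    intro z hz
    have h1 : P 0 z * C 2 z + C 0 z * P 2 z - C 1 z * P 1 z
      + 4 * (z ^ 2 - ν ^ 2) * C 0 z * P 0 z = 4 * ν * C 0 z ^ 2 :=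
      coshNicholsonOrder_first_integral ν hz
    have ha3 : a 3 z = 4 * ν ^ 2 * a 1 z + 2 * ν - 4 * z ^ 2 * (a 1 z + a 0 z) :=
      expNicholson_three ν hz
    have hb3 : b 3 z = 4 * (-ν) ^ 2 * b 1 z + 2 * (-ν) - 4 * z ^ 2 * (b 1 z + b 0 z) :=
      expNicholson_three (-ν) hz
    have hCj : ∀ j, C j z = (a j z + b j z) / 2 := fun j => rfl
    simp only [hE0, hE1, hE2, ha3, hb3]
    simp only [hCj] at h1 ⊢
    linear_combination h1
  have hR : ∀ z, 0 < z → 2 * C 0 z * C 2 z - C 1 z ^ 2 + 4 * (z ^ 2 - ν ^ 2) * C 0 z ^ 2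
      = π ^ 2 / 4 := fun z hz => coshNicholson_first_integral ν hz
  have tC1 : Tendsto (C 1) atTop (nhds 0) := tendsto_coshNicholson 1 ν
  have tzC : Tendsto (fun z => z * C 0 z) atTop (nhds (π / 4)) := tendsto_mul_coshNicholson_zero ν
  have tzE0 : Tendsto (fun z => z * E0 z) atTop (nhds 0) := by
    have := (tendsto_mul_coshNicholsonOrder 0 ν).sub
      (((tendsto_mul_expNicholson_zero (-ν)).mul (tendsto_expNicholson 1 ν)).sub
      ((tendsto_mul_expNicholson_zero ν).mul (tendsto_expNicholson 1 (-ν))))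
    convert this using 2
    · simp only [hE0, hP, ha, hb]; ring
    · ring
  have tE1 : Tendsto E1 atTop (nhds 0) := by
    have hP1 : Tendsto (fun z : ℝ => z⁻¹ * (z * P 1 z)) atTop (nhds (0 * 0)) :=
      tendsto_inv_atTop_zero.mul (tendsto_mul_coshNicholsonOrder 1 ν)
    have := hP1.sub
      (((tendsto_expNicholson 0 (-ν)).mul (tendsto_expNicholson 2 ν)).sub
      ((tendsto_expNicholson 0 ν).mul (tendsto_expNicholson 2 (-ν))))
    have h0 : (0 * 0 - (0 * 0 - 0 * 0) : ℝ) = 0 := by ring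
    rw [h0] at this
    refine this.congr' ?_
    filter_upwards [eventually_gt_atTop 0] with z hz
    rw [inv_mul_cancel_left₀ hz.ne']
  have tw : Tendsto (fun z => E0 z / C 0 z) atTop (nhds 0) := by
    have hpi : π / 4 ≠ 0 := by positivity
    have := tzE0.div tzC hpi
    rw [zero_div] at this
    refine this.congr' ?_
    filter_upwards [eventually_gt_atTop 0] with z hz
    exact mul_div_mul_left _ _ hz.ne'
  have hEz : E0 z = coshNicholsonOrder 0 ν z - (expNicholson 0 (-ν) z * expNicholson 1 ν z
      - expNicholson 0 ν z * expNicholson 1 (-ν) z) := rfl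
  clear_value C P
  have hQ : π ^ 2 / 4 * (E0 z / C 0 z) ^ 2 + (E1 z - E0 z / C 0 z * C 1 z) ^ 2 = 0 := by
    refine eq_of_deriv_zero_of_tendsto (f := fun z => π ^ 2 / 4 * (E0 z / C 0 z) ^ 2
      + (E1 z - E0 z / C 0 z * C 1 z) ^ 2) ?_ ?_ hz
    · intro z hz
      have hw := (dE0 z hz).div (dC 0 (by norm_num) z hz) (hCpos z hz)
      refine (((hw.pow 2).const_mul (π ^ 2 / 4)).add
        (((dE1 z hz).sub (hw.mul (dC 1 (by norm_num) z hz))).pow 2)).congr_deriv ?_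
      have hc := hCpos z hz
      rw [← hR z hz]
      have h2 : E2 z = (-(E0 z * C 2 z) + C 1 z * E1 z
        - 4 * (z ^ 2 - ν ^ 2) * C 0 z * E0 z) / C 0 z := by
        rw [eq_div_iff hc]; linear_combination hrel z hz
      simp only [zero_add, Nat.reduceAdd, Pi.div_apply, Pi.mul_apply, Pi.sub_apply, h2]
      field_simp
      ring
    · have := ((tw.pow 2).const_mul (π ^ 2 / 4)).add ((tE1.sub (tw.mul tC1)).pow 2)
      convert this using 2
      ring
  have hw : E0 z / C 0 z = 0 := by
    have hpi := Real.pi_pos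
    have h1 : 0 ≤ (E1 z - E0 z / C 0 z * C 1 z) ^ 2 := sq_nonneg _
    have h2 : (E0 z / C 0 z) ^ 2 = 0 := by
      have : 0 ≤ (E0 z / C 0 z) ^ 2 := sq_nonneg _
      have h3 : π ^ 2 / 4 * (E0 z / C 0 z) ^ 2 ≤ 0 := by linarith
      have h4 : 0 < π ^ 2 / 4 := by positivity
      exact le_antisymm (nonpos_of_mul_nonpos_right h3 h4) this
    exact pow_eq_zero_iff two_ne_zero |>.1 h2
  have hE : E0 z = 0 := (div_eq_zero_iff.1 hw).resolve_right (hCpos z hz)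
  rw [hEz] at hE
  exact sub_eq_zero.1 hE

lemma abs_nicholson_le (j : ℕ) {g : ℝ → ℝ} {A b z₀ z : ℝ} (hz₀ : 0 < z₀)
    (hz : z₀ ≤ z) (hg : ∀ t : ℝ, 0 < t → |g t| ≤ A * Real.exp (b * t)) :
    |nicholson j g z| ≤ ∫ t in Ioi (0:ℝ), A * domConst z₀ b *
      (Real.exp (-t) * t ^ ((1 / 2 : ℝ) - 1)) := by
  rw [← Real.norm_eq_abs]
  refine norm_integral_le_of_norm_le (integrableOn_exp_neg_mul_rpow _) ?_
  filter_upwards [ae_restrict_mem measurableSet_Ioi] with t ht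
  have h1 := abs_eulerK0_sinh_mul_exp_le j b hz₀ hz ht
  have h2 := hg t ht
  have hA : 0 ≤ A := nonneg_of_mul_nonneg_left ((abs_nonneg _).trans h2) (Real.exp_pos _)
  rw [Real.norm_eq_abs, abs_mul]
  calc _ ≤ |eulerK0 j (2 * z * Real.sinh t)| * (A * Real.exp (b * t)) := by gcongr
    _ = A * (|eulerK0 j (2 * z * Real.sinh t)| * Real.exp (b * t)) := by ring
    _ ≤ A * (domConst z₀ b * (Real.exp (-t) * t ^ ((1 / 2 : ℝ) - 1))) := by gcongr
    _ = _ := by ring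

lemma abs_coshNicholsonOrder_le (j : ℕ) (R : ℝ) {z₀ : ℝ} (hz₀ : 0 < z₀) :
    ∃ M : ℝ, ∀ ν z, |ν| ≤ R → z₀ ≤ z → |coshNicholsonOrder j ν z| ≤ M := by
  refine ⟨∫ t in Ioi (0:ℝ), 2 * domConst z₀ (2 * R + 1) *
      (Real.exp (-t) * t ^ ((1 / 2 : ℝ) - 1)), fun ν z hν hz => ?_⟩
  have hw : ∀ μ : ℝ, |μ| ≤ R → ∀ t : ℝ, 0 < t →
      |-2 * t * Real.exp (-2 * μ * t)| ≤ 2 * Real.exp ((2 * R + 1) * t) := by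
    intro μ hμ t ht
    have h1 := mul_exp_order_abs_le μ t ht
    have h2 : t ≤ Real.exp t := by linarith [Real.add_one_le_exp t]
    have h3 : Real.exp (2 * |μ| * t) ≤ Real.exp (2 * R * t) := by
      apply Real.exp_le_exp.2; gcongr
    calc _ ≤ 2 * t ^ 1 * Real.exp (2 * |μ| * t) := h1
      _ ≤ 2 * Real.exp t * Real.exp (2 * R * t) := by rw [pow_one]; gcongr
      _ = _ := by rw [mul_assoc, ← Real.exp_add]; ring_nf
  have h1 := abs_nicholson_le j hz₀ hz (hw ν hν)
  have h2 := abs_nicholson_le j hz₀ hz (hw (-ν) (by rwa [abs_neg]))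
  unfold coshNicholsonOrder expNicholsonOrder
  rw [abs_div, abs_two, div_le_iff₀ two_pos]
  refine (abs_sub _ _).trans ?_
  linarith

lemma expNicholson_zero_nonneg (ν z : ℝ) : 0 ≤ expNicholson 0 ν z :=
  MeasureTheory.integral_nonneg fun _ => mul_nonneg (K0_nonneg _) (Real.exp_pos _).le

lemma expNicholson_zero_antitone {μ ν z : ℝ} (hz : 0 < z) (h : μ ≤ ν) :
    expNicholson 0 ν z ≤ expNicholson 0 μ z := by
  refine setIntegral_mono_on (integrableOn_nicholson 0 (expWeight_exp _) hz)
    (integrableOn_nicholson 0 (expWeight_exp _) hz) measurableSet_Ioi fun t ht => ?_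
  have ht0 : 0 < t := ht
  refine mul_le_mul_of_nonneg_left (Real.exp_le_exp.2 ?_) (K0_nonneg _)
  nlinarith

lemma coshNicholson_zero_eq (ν : ℝ) {z : ℝ} (hz : 0 < z) :
    IntegrableOn (fun t => K0 (2 * z * Real.sinh t) * Real.cosh (2 * ν * t)) (Ioi 0) ∧
      ∫ t in Ioi (0:ℝ), K0 (2 * z * Real.sinh t) * Real.cosh (2 * ν * t)
        = coshNicholson 0 ν z := by
  have h1 := integrableOn_nicholson 0 (expWeight_exp ν) hz
  have h2 := integrableOn_nicholson 0 (expWeight_exp (-ν)) hz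
  have he : (fun t => K0 (2 * z * Real.sinh t) * Real.cosh (2 * ν * t)) = fun t =>
      (eulerK0 0 (2 * z * Real.sinh t) * Real.exp (-2 * ν * t)
        + eulerK0 0 (2 * z * Real.sinh t) * Real.exp (-2 * -ν * t)) / 2 := by
    ext t
    rw [Real.cosh_eq]
    simp only [eulerK0]
    ring_nf
  rw [he]
  refine ⟨(h1.add h2).div_const 2, ?_⟩
  rw [MeasureTheory.integral_div, MeasureTheory.integral_add h1 h2]
  rfl

lemma coshNicholson_zero_mono {μ ν z : ℝ} (hz : 0 < z) (h : |μ| ≤ |ν|) :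
    coshNicholson 0 μ z ≤ coshNicholson 0 ν z := by
  obtain ⟨i1, e1⟩ := coshNicholson_zero_eq μ hz
  obtain ⟨i2, e2⟩ := coshNicholson_zero_eq ν hz
  rw [← e1, ← e2]
  refine setIntegral_mono_on i1 i2 measurableSet_Ioi fun t _ => ?_
  refine mul_le_mul_of_nonneg_left (Real.cosh_le_cosh.2 ?_) (K0_nonneg _)
  simp only [abs_mul]
  gcongr

lemma coshNicholson_zero_half {z : ℝ} (hz : 0 < z) : coshNicholson 0 (1 / 2) z = π / (4 * z) := by
  obtain ⟨hi, he⟩ := laplace_K0 (a := 0) (by norm_num) (by norm_num)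
  simp only [neg_zero, zero_mul, Real.exp_zero, mul_one] at hi he
  obtain ⟨-, h⟩ := integral_sinh_scale hz hi
  rw [← (coshNicholson_zero_eq (1 / 2) hz).2]
  have : (fun t => K0 (2 * z * Real.sinh t) * Real.cosh (2 * (1 / 2) * t))
      = fun t => K0 (2 * z * Real.sinh t) * Real.cosh t := by
    ext t; norm_num
  rw [this, h, he, Real.arccos_zero]
  norm_num
  field_simp
  norm_num

/-- The integrand of the phase, up to a constant factor. -/
noncomputable def phaseDensity (ν z : ℝ) : ℝ := π / (4 * z * coshNicholson 0 ν z)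

/-- The quotient whose order integral is the phase. -/
noncomputable def nicholsonRatio (ν z : ℝ) : ℝ := expNicholson 0 ν z / coshNicholson 0 ν z

lemma hasDerivAt_nicholsonRatio (ν : ℝ) {z : ℝ} (hz : 0 < z) :
    HasDerivAt (nicholsonRatio ν)
      (coshNicholsonOrder 0 ν z / (2 * z * coshNicholson 0 ν z ^ 2)) z := by
  have hc := (coshNicholson_zero_pos ν hz).ne'
  refine ((hasDerivAt_expNicholson (j := 0) (by norm_num) ν hz).div
    (hasDerivAt_coshNicholson (j := 0) (by norm_num) ν hz) hc).congr_deriv ?_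
  rw [coshNicholsonOrder_zero_eq ν hz]
  have h1 : coshNicholson 1 ν z = (expNicholson 1 ν z + expNicholson 1 (-ν) z) / 2 := rfl
  have h2 : expNicholson 0 (-ν) z = 2 * coshNicholson 0 ν z - expNicholson 0 ν z := by
    unfold coshNicholson; ring
  simp only [zero_add, h1, h2]
  field_simp
  ring

lemma hasDerivAt_phaseDensity_order (ν : ℝ) {z : ℝ} (hz : 0 < z) :
    HasDerivAt (fun μ => phaseDensity μ z)
      (-(π / 2) * (coshNicholsonOrder 0 ν z / (2 * z * coshNicholson 0 ν z ^ 2))) ν := by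
  have hc := (coshNicholson_zero_pos ν hz).ne'
  refine ((hasDerivAt_const ν π).div ((hasDerivAt_coshNicholson_order 0 ν hz).const_mul (4 * z))
    (by positivity)).congr_deriv ?_
  field_simp
  ring

lemma continuous_nicholsonRatio_order {z : ℝ} (hz : 0 < z) :
    Continuous fun μ => nicholsonRatio μ z := by
  refine continuous_iff_continuousAt.2 fun ν => ?_
  exact (hasDerivAt_expNicholson_order 0 ν hz).continuousAt.div
    (hasDerivAt_coshNicholson_order 0 ν hz).continuousAt (coshNicholson_zero_pos ν hz).ne'

lemma continuousOn_coshNicholson {j : ℕ} (hj : j < 3) (ν : ℝ) :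
    ContinuousOn (coshNicholson j ν) (Ioi 0) := fun _ hz =>
  (hasDerivAt_coshNicholson hj ν hz).continuousAt.continuousWithinAt

lemma continuousOn_coshNicholsonOrder {j : ℕ} (hj : j < 3) (ν : ℝ) :
    ContinuousOn (coshNicholsonOrder j ν) (Ioi 0) := fun _ hz =>
  (hasDerivAt_coshNicholsonOrder hj ν hz).continuousAt.continuousWithinAt

lemma continuousOn_phaseDensity (ν : ℝ) : ContinuousOn (phaseDensity ν) (Ioi 0) := by
  refine continuousOn_const.div ((continuousOn_const.mul continuousOn_id).mul
    (continuousOn_coshNicholson (by norm_num) ν)) fun z hz => ?_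
  have hz0 : 0 < z := hz
  have := coshNicholson_zero_pos ν hz0
  positivity

lemma continuousOn_order_quotient (ν : ℝ) : ContinuousOn
    (fun z => coshNicholsonOrder 0 ν z / (2 * z * coshNicholson 0 ν z ^ 2)) (Ioi 0) := by
  refine (continuousOn_coshNicholsonOrder (by norm_num) ν).div
    ((continuousOn_const.mul continuousOn_id).mul
    ((continuousOn_coshNicholson (by norm_num) ν).pow 2)) fun z hz => ?_
  have hz0 : 0 < z := hz
  have := coshNicholson_zero_pos ν hz0
  positivity

lemma hasDerivAt_integral_phaseDensity (ν : ℝ) {ε Z : ℝ} (hε : 0 < ε) (hZ : ε ≤ Z) :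
    HasDerivAt (fun μ => ∫ u in ε..Z, phaseDensity μ u)
      (-(π / 2) * (nicholsonRatio ν Z - nicholsonRatio ν ε)) ν := by
  obtain ⟨M, hM⟩ := abs_coshNicholsonOrder_le 0 (|ν| + 1) hε
  have hsub : uIcc ε Z ⊆ Ioi 0 := by
    rw [uIcc_of_le hZ]
    exact fun u hu => hε.trans_le hu.1
  have hsub' : uIoc ε Z ⊆ Ioi 0 := uIoc_subset_uIcc.trans hsub
  have hbc : ContinuousOn (fun u => π / 2 * (M / (2 * u * coshNicholson 0 0 u ^ 2))) (Ioi 0) := by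
    refine continuousOn_const.mul (continuousOn_const.div
      ((continuousOn_const.mul continuousOn_id).mul
      ((continuousOn_coshNicholson (by norm_num) 0).pow 2)) fun z hz => ?_)
    have hz0 : 0 < z := hz
    have := coshNicholson_zero_pos 0 hz0
    positivity
  have h := (intervalIntegral.hasDerivAt_integral_of_dominated_loc_of_deriv_le
    (μ := volume) (a := ε) (b := Z) (x₀ := ν) (s := Metric.ball ν 1)
    (F := phaseDensity)
    (F' := fun μ u => -(π / 2) * (coshNicholsonOrder 0 μ u / (2 * u * coshNicholson 0 μ u ^ 2)))
    (bound := fun u => π / 2 * (M / (2 * u * coshNicholson 0 0 u ^ 2)))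
    (Metric.ball_mem_nhds ν one_pos)
    (Eventually.of_forall fun μ => ((continuousOn_phaseDensity μ).mono
      hsub').aestronglyMeasurable measurableSet_uIoc)
    (((continuousOn_phaseDensity ν).mono hsub).intervalIntegrable)
    (((continuousOn_const.mul (continuousOn_order_quotient ν)).mono
      hsub').aestronglyMeasurable measurableSet_uIoc)
    (Eventually.of_forall fun u hu μ hμ => ?_)
    ((hbc.mono hsub).intervalIntegrable)
    (Eventually.of_forall fun u hu μ _ => hasDerivAt_phaseDensity_order μ (hsub' hu))).2
  · refine h.congr_deriv ?_
    rw [intervalIntegral.integral_const_mul,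
      integral_eq_sub_of_hasDerivAt (fun u hu => hasDerivAt_nicholsonRatio ν (hsub hu))
      ((continuousOn_order_quotient ν).mono hsub).intervalIntegrable]
  · have hu0 : 0 < u := hsub' hu
    have huε : ε ≤ u := by
      rw [uIoc_of_le hZ] at hu
      exact hu.1.le
    have hμ' : |μ| ≤ |ν| + 1 := by
      have h1 : |μ - ν| < 1 := hμ
      have h2 := abs_sub_abs_le_abs_sub μ ν
      linarith
    have h0 := coshNicholson_zero_pos 0 hu0
    have h1 : coshNicholson 0 0 u ≤ coshNicholson 0 μ u :=
      coshNicholson_zero_mono hu0 (by simp)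
    have h2 := hM μ u hμ' huε
    have h3 := h0.trans_le h1
    rw [Real.norm_eq_abs, abs_mul, abs_neg, abs_of_pos (by positivity : 0 < π / 2), abs_div,
      abs_of_pos (by positivity : 0 < 2 * u * coshNicholson 0 μ u ^ 2)]
    have hM0 : 0 ≤ M := (abs_nonneg _).trans h2
    gcongr

lemma phaseDensity_half {z : ℝ} (hz : 0 < z) : phaseDensity (1 / 2) z = 1 := by
  unfold phaseDensity
  rw [coshNicholson_zero_half hz]
  field_simp

lemma phaseDensity_nonneg (ν : ℝ) {z : ℝ} (hz : 0 < z) : 0 ≤ phaseDensity ν z := by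
  have := coshNicholson_zero_pos ν hz
  unfold phaseDensity
  positivity

lemma phaseDensity_le_one {ν z : ℝ} (hν : 1 / 2 ≤ ν) (hz : 0 < z) : phaseDensity ν z ≤ 1 := by
  rw [← phaseDensity_half hz]
  have h1 := coshNicholson_zero_pos (1 / 2) hz
  have h2 : coshNicholson 0 (1 / 2) z ≤ coshNicholson 0 ν z :=
    coshNicholson_zero_mono hz (by rw [abs_of_pos (by norm_num), abs_of_pos (by linarith)]; exact hν)
  unfold phaseDensity
  gcongr

lemma intervalIntegrable_phaseDensity {ν Z : ℝ} (hν : 1 / 2 ≤ ν) (hZ : 0 ≤ Z) :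
    IntervalIntegrable (phaseDensity ν) volume 0 Z := by
  rw [intervalIntegrable_iff_integrableOn_Ioc_of_le hZ]
  have h1 : IntegrableOn (fun _ : ℝ => (1:ℝ)) (Ioc 0 Z) := integrableOn_const (by simp)
  refine Integrable.mono' h1 ?_ ?_
  · exact ((continuousOn_phaseDensity ν).mono fun u hu => hu.1).aestronglyMeasurable
      measurableSet_Ioc
  · filter_upwards [ae_restrict_mem measurableSet_Ioc] with u hu
    rw [Real.norm_of_nonneg (phaseDensity_nonneg ν hu.1)]
    exact phaseDensity_le_one hν hu.1

lemma integral_phaseDensity_sub {ν ε Z : ℝ} (hε : 0 < ε) (hZ : ε ≤ Z) :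
    ∫ u in ε..Z, phaseDensity ν u = Z - ε
      - π / 2 * ((∫ μ in (1 / 2)..ν, nicholsonRatio μ Z)
        - ∫ μ in (1 / 2)..ν, nicholsonRatio μ ε) := by
  have cZ := continuous_nicholsonRatio_order (hε.trans_le hZ)
  have cε := continuous_nicholsonRatio_order hε
  have h := integral_eq_sub_of_hasDerivAt (a := 1 / 2) (b := ν)
    (fun μ _ => hasDerivAt_integral_phaseDensity μ hε hZ)
    ((continuous_const.mul (cZ.sub cε)).intervalIntegrable _ _)
  rw [intervalIntegral.integral_const_mul, intervalIntegral.integral_sub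
    (cZ.intervalIntegrable _ _) (cε.intervalIntegrable _ _)] at h
  have h1 : ∫ u in ε..Z, phaseDensity (1 / 2) u = Z - ε := by
    rw [intervalIntegral.integral_congr (g := fun _ => (1:ℝ)) fun u hu => ?_]
    · simp
    · rw [uIcc_of_le hZ] at hu
      exact phaseDensity_half (hε.trans_le hu.1)
  rw [h1] at h
  linarith

lemma abs_nicholsonRatio_le {μ z : ℝ} (hμ : 1 / 2 ≤ μ) (hz : 0 < z) :
    |nicholsonRatio μ z| ≤ 4 / π * (20480 * Real.Gamma (1 / 2)) * z ^ (1 / 2 : ℝ) := by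
  have h0 := coshNicholson_zero_pos μ hz
  have h1 : π / (4 * z) ≤ coshNicholson 0 μ z := by
    rw [← coshNicholson_zero_half hz]
    exact coshNicholson_zero_mono hz
      (by rw [abs_of_pos (by norm_num), abs_of_pos (by linarith)]; exact hμ)
  have h2 := expNicholson_zero_nonneg μ z
  have h3 := expNicholson_zero_antitone hz hμ
  have h4 : z * expNicholson 0 (1 / 2) z ≤ _ := nicholson_zero_half_le hz
  unfold nicholsonRatio
  rw [abs_of_nonneg (by positivity)]
  calc _ ≤ expNicholson 0 (1 / 2) z / (π / (4 * z)) := by gcongr; exact h2.trans h3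
    _ = 4 / π * (z * expNicholson 0 (1 / 2) z) := by field_simp
    _ ≤ 4 / π * (20480 * Real.Gamma (1 / 2) * z ^ (1 / 2 : ℝ)) := by gcongr
    _ = _ := by ring

/-- The phase integral expressed as an integral over the order. -/
lemma integral_phaseDensity_eq {ν Z : ℝ} (hν : 1 / 2 ≤ ν) (hZ : 0 < Z) :
    ∫ u in (0:ℝ)..Z, phaseDensity ν u
      = Z - π / 2 * ∫ μ in (1 / 2)..ν, nicholsonRatio μ Z := by
  set K := 4 / π * (20480 * Real.Gamma (1 / 2)) with hK
  set X := (∫ u in (0:ℝ)..Z, phaseDensity ν u)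
    - (Z - π / 2 * ∫ μ in (1 / 2)..ν, nicholsonRatio μ Z) with hX
  have hb : ∀ ε, 0 < ε → ε < Z →
      |X| ≤ 2 * ε + π / 2 * (K * ε ^ (1 / 2 : ℝ) * (ν - 1 / 2)) := by
    intro ε hε hεZ
    have hi := intervalIntegrable_phaseDensity hν hZ.le
    have hi0 := intervalIntegrable_phaseDensity hν hε.le
    have hi1 : IntervalIntegrable (phaseDensity ν) volume ε Z := hi0.symm.trans hi
    have hs := integral_add_adjacent_intervals hi0 hi1
    have h1 := integral_phaseDensity_sub (ν := ν) hε hεZ.le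
    have h2 : |∫ u in (0:ℝ)..ε, phaseDensity ν u| ≤ 1 * |ε - 0| := by
      rw [← Real.norm_eq_abs]
      refine intervalIntegral.norm_integral_le_of_norm_le_const fun u hu => ?_
      rw [uIoc_of_le hε.le] at hu
      rw [Real.norm_of_nonneg (phaseDensity_nonneg ν hu.1)]
      exact phaseDensity_le_one hν hu.1
    have h3 : |∫ μ in (1 / 2)..ν, nicholsonRatio μ ε|
        ≤ K * ε ^ (1 / 2 : ℝ) * |ν - 1 / 2| := by
      rw [← Real.norm_eq_abs]
      refine intervalIntegral.norm_integral_le_of_norm_le_const fun μ hμ => ?_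
      rw [uIoc_of_le hν] at hμ
      exact abs_nicholsonRatio_le hμ.1.le hε
    rw [sub_zero, abs_of_pos hε] at h2
    rw [abs_of_nonneg (by linarith : 0 ≤ ν - 1 / 2)] at h3
    have hX' : X = (∫ u in (0:ℝ)..ε, phaseDensity ν u) - ε
        + π / 2 * ∫ μ in (1 / 2)..ν, nicholsonRatio μ ε := by
      rw [hX, ← hs, h1]; ring
    rw [hX']
    refine (abs_add_le _ _).trans (add_le_add ?_ ?_)
    · refine (abs_sub _ _).trans ?_
      rw [abs_of_pos hε]
      linarith
    · rw [abs_mul, abs_of_pos (by positivity : 0 < π / 2)]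
      gcongr
  have hlim : Tendsto (fun ε : ℝ => 2 * ε + π / 2 * (K * ε ^ (1 / 2 : ℝ) * (ν - 1 / 2)))
      (nhdsWithin 0 (Ioi 0)) (nhds 0) := by
    have hc : Continuous fun ε : ℝ => 2 * ε + π / 2 * (K * ε ^ (1 / 2 : ℝ) * (ν - 1 / 2)) := by
      have := Real.continuous_rpow_const (q := 1 / 2) (by norm_num)
      fun_prop
    have := hc.tendsto 0
    rw [Real.zero_rpow (by norm_num)] at this
    simp only [mul_zero, zero_mul, add_zero] at this
    exact this.mono_left nhdsWithin_le_nhds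
  have hX0 : |X| ≤ 0 := by
    refine ge_of_tendsto hlim ?_
    filter_upwards [Ioo_mem_nhdsGT hZ] with ε hε
    exact hb ε hε.1 hε.2
  exact sub_eq_zero.1 (abs_nonpos_iff.1 hX0)

lemma phase_eq {ν z : ℝ} (hz : 0 < z) :
    phase ν z = -(π / 2) + ∫ u in (0:ℝ)..z, phaseDensity ν u := by
  unfold phase
  rw [← intervalIntegral.integral_const_mul]
  congr 1
  refine intervalIntegral.integral_congr_ae (Eventually.of_forall fun u hu => ?_)
  rw [uIoc_of_le hz.le] at hu
  have hu0 : 0 < u := hu.1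
  have := coshNicholson_zero_pos ν hu0
  unfold M2 phaseDensity
  rw [(coshNicholson_zero_eq ν hu0).2]
  field_simp
  norm_num

lemma nicholsonRatio_approx {q : ℝ} (hq : q < 1) :
    ∃ K : ℝ, 0 ≤ K ∧ ∀ z μ : ℝ, 0 < z → 1 / 2 ≤ μ → μ ≤ q * z →
      |π / 2 * nicholsonRatio μ z - Real.arccos (μ / z)| ≤ K / z ^ 2 := by
  obtain ⟨K, hK0, hK⟩ := nicholson_approx hq
  refine ⟨3 * π * K, by positivity, fun z μ hz hμ hμz => ?_⟩
  have habs : |μ| = μ := abs_of_pos (by linarith)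
  have hx : |z * expNicholson 0 μ z - Real.arccos (μ / z) / √(1 - (μ / z) ^ 2) / 2| ≤ K / z ^ 2 :=
    hK z μ hz (by rwa [habs])
  have hy : |z * expNicholson 0 (-μ) z
      - Real.arccos (-μ / z) / √(1 - (-μ / z) ^ 2) / 2| ≤ K / z ^ 2 :=
    hK z (-μ) hz (by rwa [abs_neg, habs])
  have h0 := coshNicholson_zero_pos μ hz
  have hsum : π / 2 ≤ z * expNicholson 0 μ z + z * expNicholson 0 (-μ) z := by
    have h1 : coshNicholson 0 (1 / 2) z ≤ coshNicholson 0 μ z :=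
      coshNicholson_zero_mono hz (by rw [habs, abs_of_pos (by norm_num)]; exact hμ)
    rw [coshNicholson_zero_half hz, div_le_iff₀ (by positivity)] at h1
    unfold coshNicholson at h1
    linarith
  rw [neg_div, Real.arccos_neg, neg_sq] at hy
  set α := Real.arccos (μ / z) with hα
  set s := √(1 - (μ / z) ^ 2) with hs
  set x := z * expNicholson 0 μ z with hxd
  set y := z * expNicholson 0 (-μ) z with hyd
  have hpi := Real.pi_gt_three
  have hα0 : 0 ≤ α := Real.arccos_nonneg _
  have hαπ : α ≤ π := Real.arccos_le_pi _
  have hratio : nicholsonRatio μ z = 2 * x / (x + y) := by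
    have hc : x + y = 2 * z * coshNicholson 0 μ z := by
      unfold coshNicholson; rw [hxd, hyd]; ring
    unfold nicholsonRatio
    rw [hc, hxd]
    field_simp
  have hne : x + y ≠ 0 := by linarith
  have heq : π / 2 * nicholsonRatio μ z - α
      = (π * (x - α / s / 2) - α * ((x - α / s / 2) + (y - (π - α) / s / 2))) / (x + y) := by
    rw [hratio, eq_div_iff hne]
    have : (π / 2 * (2 * x / (x + y)) - α) * (x + y) = π * x - α * (x + y) := by
      field_simp
    rw [this]
    ring
  rw [heq, abs_div, abs_of_pos (by linarith : 0 < x + y)]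
  refine (div_le_self (abs_nonneg _) (by linarith)).trans ?_
  refine (abs_sub _ _).trans ?_
  rw [abs_mul, abs_mul, abs_of_pos Real.pi_pos, abs_of_nonneg hα0]
  have h3 := (abs_add_le (x - α / s / 2) (y - (π - α) / s / 2)).trans (add_le_add hx hy)
  calc _ ≤ π * (K / z ^ 2) + π * (K / z ^ 2 + K / z ^ 2) := by gcongr
    _ = _ := by ring

lemma hasDerivAt_mul_arccos_sub_sqrt {μ z : ℝ} (h0 : 0 ≤ μ) (h : μ < z) :
    HasDerivAt (fun μ => μ * Real.arccos (μ / z) - √(z ^ 2 - μ ^ 2)) (Real.arccos (μ / z)) μ := by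
  have hz : 0 < z := h0.trans_lt h
  have h1 : μ / z < 1 := (div_lt_one hz).2 h
  have h2 : 0 ≤ μ / z := by positivity
  have hd : 0 < z ^ 2 - μ ^ 2 := by nlinarith
  have hs : √(1 - (μ / z) ^ 2) = √(z ^ 2 - μ ^ 2) / z := by
    rw [show 1 - (μ / z) ^ 2 = (z ^ 2 - μ ^ 2) / z ^ 2 by field_simp, Real.sqrt_div hd.le,
      Real.sqrt_sq hz.le]
  have ha : HasDerivAt (fun μ => Real.arccos (μ / z)) (-(1 / √(1 - (μ / z) ^ 2)) * (1 / z)) μ :=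
    HasDerivAt.comp (h₂ := Real.arccos) μ (Real.hasDerivAt_arccos (by linarith) h1.ne)
      ((hasDerivAt_id μ).div_const z)
  have hq := ((hasDerivAt_pow 2 μ).const_sub (z ^ 2)).sqrt hd.ne'
  refine (((hasDerivAt_id μ).mul ha).sub hq).congr_deriv ?_
  have hsp := Real.sqrt_pos.2 hd
  rw [hs]
  simp only [id]
  field_simp
  norm_num
  ring

lemma integral_arccos_div {a b z : ℝ} (ha : 0 ≤ a) (hab : a ≤ b) (hb : b < z) :
    ∫ μ in a..b, Real.arccos (μ / z) = b * Real.arccos (b / z) - √(z ^ 2 - b ^ 2)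
      - (a * Real.arccos (a / z) - √(z ^ 2 - a ^ 2)) := by
  refine integral_eq_sub_of_hasDerivAt (f := fun μ => μ * Real.arccos (μ / z) - √(z ^ 2 - μ ^ 2))
    (fun μ hμ => ?_) ?_
  · rw [uIcc_of_le hab] at hμ
    exact hasDerivAt_mul_arccos_sub_sqrt (ha.trans hμ.1) (hμ.2.trans_lt hb)
  · exact (Real.continuous_arccos.comp (continuous_id.div_const z)).intervalIntegrable _ _

lemma phase_debye_error {c : ℝ} (hc : 1 < c) : ∃ K : ℝ, ∀ ν : ℝ, 1 / 2 ≤ ν →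
    |(phase ν (c * ν) - ν * √(c ^ 2 - 1) + ν * Real.arccos (1 / c) + π / 4)
      - ((Real.arccos (1 / (2 * (c * ν))) / 2 - π / 4)
        + (c * ν - √((c * ν) ^ 2 - (1 / 2) ^ 2)))| ≤ K / ν := by
  have hc0 : 0 < c := by linarith
  obtain ⟨K, hK0, hK⟩ := nicholsonRatio_approx (q := 1 / c) ((div_lt_one hc0).2 hc)
  refine ⟨K / c ^ 2, fun ν hν => ?_⟩
  have hν0 : 0 < ν := by linarith
  set z := c * ν with hz
  have hz0 : 0 < z := by positivity
  have hνz : ν < z := by rw [hz]; nlinarith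
  have hcr : Continuous fun μ => π / 2 * nicholsonRatio μ z :=
    continuous_const.mul (continuous_nicholsonRatio_order hz0)
  have hca : Continuous fun μ => Real.arccos (μ / z) :=
    Real.continuous_arccos.comp (continuous_id.div_const z)
  have herr : |(∫ μ in (1 / 2)..ν, π / 2 * nicholsonRatio μ z)
      - ∫ μ in (1 / 2)..ν, Real.arccos (μ / z)| ≤ K / z ^ 2 * |ν - 1 / 2| := by
    rw [← intervalIntegral.integral_sub (hcr.intervalIntegrable _ _) (hca.intervalIntegrable _ _),
      ← Real.norm_eq_abs]
    refine intervalIntegral.norm_integral_le_of_norm_le_const fun μ hμ => ?_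
    rw [uIoc_of_le hν] at hμ
    refine hK z μ hz0 hμ.1.le ?_
    rw [hz]
    field_simp
    exact hμ.2
  rw [intervalIntegral.integral_const_mul, integral_arccos_div (by norm_num) hν hνz] at herr
  have hdiv : ν / z = 1 / c := by rw [hz]; field_simp
  have hsq : √(z ^ 2 - ν ^ 2) = ν * √(c ^ 2 - 1) := by
    rw [show z ^ 2 - ν ^ 2 = ν ^ 2 * (c ^ 2 - 1) by rw [hz]; ring,
      Real.sqrt_mul (by positivity), Real.sqrt_sq hν0.le]
  have hhalf : 1 / 2 / z = 1 / (2 * z) := by field_simp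
  rw [hdiv, hsq, hhalf, abs_of_nonneg (by linarith : 0 ≤ ν - 1 / 2)] at herr
  rw [phase_eq hz0, integral_phaseDensity_eq hν hz0]
  have hle : K / z ^ 2 * (ν - 1 / 2) ≤ K / c ^ 2 / ν := by
    calc _ ≤ K / z ^ 2 * ν := by gcongr; linarith
      _ = _ := by rw [hz]; field_simp
  refine le_trans (le_of_eq ?_) (herr.trans hle)
  rw [← abs_neg]
  congr 1
  ring

lemma tendsto_sub_sqrt_sq_sub (a : ℝ) :
    Tendsto (fun z : ℝ => z - √(z ^ 2 - a ^ 2)) atTop (nhds 0) := by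
  have hlim : Tendsto (fun z : ℝ => a ^ 2 / z) atTop (nhds 0) :=
    tendsto_const_nhds.div_atTop tendsto_id
  refine squeeze_zero' ?_ ?_ hlim
  · filter_upwards [eventually_gt_atTop 0] with z hz
    have : √(z ^ 2 - a ^ 2) ≤ z := Real.sqrt_le_iff.2 ⟨hz.le, by nlinarith [sq_nonneg a]⟩
    linarith
  · filter_upwards [eventually_gt_atTop 0, eventually_ge_atTop |a|] with z hz ha
    have h1 : 0 ≤ z ^ 2 - a ^ 2 := by
      have := sq_le_sq' (by linarith [abs_nonneg a]) ha
      rw [sq_abs] at this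
      linarith
    have h2 := Real.sq_sqrt h1
    have h3 := Real.sqrt_nonneg (z ^ 2 - a ^ 2)
    have h4 : √(z ^ 2 - a ^ 2) ≤ z := Real.sqrt_le_iff.2 ⟨hz.le, by nlinarith [sq_nonneg a]⟩
    rw [le_div_iff₀ hz]
    nlinarith

/-- Leading behavior of the Bessel phase in the Debye regime `z = cν`, `c > 1`. -/
theorem phase_debye_regime (c : ℝ) (hc : 1 < c) :
    Tendsto (fun ν : ℝ =>
        phase ν (c * ν) - ν * Real.sqrt (c ^ 2 - 1) + ν * Real.arccos (1 / c) + π / 4)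
      atTop (nhds 0) := by
  have hc0 : 0 < c := by linarith
  obtain ⟨K, hK⟩ := phase_debye_error hc
  have hz : Tendsto (fun ν : ℝ => c * ν) atTop atTop := tendsto_id.const_mul_atTop hc0
  have h1 : Tendsto (fun ν : ℝ => Real.arccos (1 / (2 * (c * ν))) / 2 - π / 4) atTop (nhds 0) := by
    have h2 : Tendsto (fun ν : ℝ => 1 / (2 * (c * ν))) atTop (nhds 0) :=
      tendsto_const_nhds.div_atTop (hz.const_mul_atTop two_pos)
    have h3 := (((Real.continuous_arccos.tendsto 0).comp h2).div_const 2).sub_const (π / 4)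
    rw [Real.arccos_zero, show π / 2 / 2 - π / 4 = 0 by ring] at h3
    exact h3
  have h2 := (tendsto_sub_sqrt_sq_sub (1 / 2)).comp hz
  have h3 : Tendsto (fun ν : ℝ =>
      (phase ν (c * ν) - ν * √(c ^ 2 - 1) + ν * Real.arccos (1 / c) + π / 4)
      - ((Real.arccos (1 / (2 * (c * ν))) / 2 - π / 4)
        + (c * ν - √((c * ν) ^ 2 - (1 / 2) ^ 2)))) atTop (nhds 0) := by
    have hlim : Tendsto (fun ν : ℝ => K / ν) atTop (nhds 0) :=
      tendsto_const_nhds.div_atTop tendsto_id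
    refine squeeze_zero_norm' ?_ hlim
    filter_upwards [eventually_ge_atTop (1 / 2)] with ν hν
    exact hK ν hν
  have h4 := h3.add (h1.add h2)
  simp only [add_zero] at h4
  refine h4.congr fun ν => ?_
  simp only [Function.comp_apply]
  ring
end

section
/- For t > 0 and real W near 0 define F(W,t) := W·t² + (cosh t)^{1/3} and φ(W,t) := sinh t/(t³·F(W,t)³) − 1/t² − √(F(W,t)⁶ − 1)/(t³·F(W,t)³) + log(F(W,t)³ + √(F(W,t)⁶ − 1))/t³. Then for every t > 0: φ(0,t) = 0, the first partial derivative ∂φ/∂W(0,t) = 0, and the second partial derivative ∂²φ/∂W²(0,t) = 9·t·(cosh t)^{1/3}/sinh t, which is positive. -/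
open Real

/-- `F(W,t) = W·t² + (cosh t)^{1/3}`. -/
noncomputable def F (W t : ℝ) : ℝ := W * t ^ 2 + (Real.cosh t) ^ ((1:ℝ)/3)

/-- The right-hand side of (eq:shortened):
`φ(W,t) = sinh t/(t³F³) − 1/t² − √(F⁶−1)/(t³F³) + arccosh(F³)/t³`,
with `arccosh y = log(y + √(y² − 1))`. -/
noncomputable def phi (W t : ℝ) : ℝ :=
  Real.sinh t / (t ^ 3 * (F W t) ^ 3) - 1 / t ^ 2
    - Real.sqrt ((F W t) ^ 6 - 1) / (t ^ 3 * (F W t) ^ 3)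
    + Real.log ((F W t) ^ 3 + Real.sqrt ((F W t) ^ 6 - 1)) / t ^ 3

lemma hasDerivAt_F (t W : ℝ) : HasDerivAt (fun W => F W t) (t ^ 2) W := by
  simpa [F] using ((hasDerivAt_id W).mul_const (t ^ 2)).add_const (Real.cosh t ^ ((1:ℝ)/3))

lemma F_zero_pow_three (t : ℝ) : F 0 t ^ 3 = Real.cosh t := by
  rw [F, zero_mul, zero_add, ← Real.rpow_natCast, ← Real.rpow_mul (Real.cosh_pos t).le]
  norm_num

lemma one_lt_F_zero {t : ℝ} (ht : 0 < t) : 1 < F 0 t := by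
  simpa [F] using Real.one_lt_rpow (Real.one_lt_cosh.2 ht.ne') (by norm_num : (0:ℝ) < 1 / 3)

lemma sqrt_F_zero_pow_six_sub_one {t : ℝ} (ht : 0 < t) : √(F 0 t ^ 6 - 1) = Real.sinh t := by
  have h : F 0 t ^ 6 - 1 = Real.sinh t ^ 2 := by
    rw [Real.sinh_sq, ← F_zero_pow_three]
    ring
  rw [h, Real.sqrt_sq (Real.sinh_pos_iff.2 ht).le]

lemma hasDerivAt_sqrt_F_pow_six_sub_one {t W : ℝ} (hF : 1 < F W t) :
    HasDerivAt (fun W => √(F W t ^ 6 - 1))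
      (3 * t ^ 2 * F W t ^ 5 / √(F W t ^ 6 - 1)) W := by
  have h : F W t ^ 6 - 1 ≠ 0 := (sub_pos.2 (one_lt_pow₀ hF (by norm_num))).ne'
  convert (((hasDerivAt_F t W).fun_pow 6).sub_const 1).sqrt h using 1
  push_cast
  ring

lemma hasDerivAt_phi {t W : ℝ} (ht : 0 < t) (hF : 1 < F W t) :
    HasDerivAt (fun W => phi W t)
      (3 * (√(F W t ^ 6 - 1) - Real.sinh t) / (t * F W t ^ 4)) W := by
  have hF0 : 0 < F W t := one_pos.trans hF
  have hpos : 0 < F W t ^ 6 - 1 := sub_pos.2 (one_lt_pow₀ hF (by norm_num))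
  have hs := hasDerivAt_sqrt_F_pow_six_sub_one hF
  have hspos := Real.sqrt_pos.2 hpos
  have hy := (hasDerivAt_F t W).fun_pow 3
  have hden := hy.const_mul (t ^ 3)
  have hden0 : t ^ 3 * F W t ^ 3 ≠ 0 := by positivity
  have hlog0 : F W t ^ 3 + √(F W t ^ 6 - 1) ≠ 0 := by positivity
  unfold phi
  refine (((((hasDerivAt_const W (Real.sinh t)).fun_div hden hden0).sub_const (1 / t ^ 2)).fun_sub
    (hs.fun_div hden hden0)).fun_add (((hy.fun_add hs).log hlog0).div_const (t ^ 3))).congr_deriv ?_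
  generalize √(F W t ^ 6 - 1) = s at *
  generalize F W t = f at *
  have hlog : (3 * f ^ 2 * t ^ 2 + 3 * t ^ 2 * f ^ 5 / s) / (f ^ 3 + s)
      = 3 * t ^ 2 * f ^ 2 / s := by
    field_simp
    ring
  norm_num [hlog]
  field_simp
  ring

/-- For every `t > 0`: `φ(0,t) = 0`, `∂φ/∂W(0,t) = 0`, and
`∂²φ/∂W²(0,t) = 9t(cosh t)^{1/3}/sinh t > 0`. -/
theorem phi_derivs_at_zero (t : ℝ) (ht : 0 < t) :
    phi 0 t = 0 ∧
    deriv (fun W => phi W t) 0 = 0 ∧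
    iteratedDeriv 2 (fun W => phi W t) 0
      = 9 * t * (Real.cosh t) ^ ((1:ℝ)/3) / Real.sinh t ∧
    0 < 9 * t * (Real.cosh t) ^ ((1:ℝ)/3) / Real.sinh t := by
  have hsinh : 0 < Real.sinh t := Real.sinh_pos_iff.2 ht
  have hF := one_lt_F_zero ht
  have hF0 : 0 < F 0 t := one_pos.trans hF
  have hs := sqrt_F_zero_pow_six_sub_one ht
  refine ⟨?_, ?_, ?_, ?_⟩
  · rw [phi, hs, F_zero_pow_three, Real.cosh_add_sinh, Real.log_exp]
    have hlin : t / t ^ 3 = 1 / t ^ 2 := by field_simp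
    linear_combination hlin
  · rw [(hasDerivAt_phi ht hF).deriv, hs]
    simp
  · have hderiv : deriv (fun W => phi W t) =ᶠ[nhds 0]
        fun W => 3 * (√(F W t ^ 6 - 1) - Real.sinh t) / (t * F W t ^ 4) := by
      filter_upwards [(hasDerivAt_F t 0).continuousAt.eventually_const_lt hF] with W hW
      exact (hasDerivAt_phi ht hW).deriv
    have hden0 : t * F 0 t ^ 4 ≠ 0 := by positivity
    have hquot := (((hasDerivAt_sqrt_F_pow_six_sub_one hF).sub_const (Real.sinh t)).const_mul
      3).fun_div (((hasDerivAt_F t 0).fun_pow 4).const_mul t) hden0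
    have hcbrt : Real.cosh t ^ ((1:ℝ)/3) = F 0 t := by simp [F]
    rw [iteratedDeriv_succ, iteratedDeriv_one, hderiv.deriv_eq, hquot.deriv, hs, hcbrt]
    field_simp
    ring
  · have := Real.cosh_pos t
    positivity
end

section
/- Fix λ with 0 < λ < 1 and set g := λ^{−2}·(1 − √(1 − λ^{12}))^{1/6} and s := √(1 − λ^{12}). Define ψ(σ) := (1 − (σ + g)^{12}·λ^{12})/(σ + g)^{6} + 12·log(σ + g) − 2s + 2·log(1 + s) for σ in a neighborhood of 0. Then ψ(0) = 0, ψ′(0) = 0, and ψ″(0) = 72·s/g², which is positive. -/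
open Real

theorem hasDerivAt_inv_pow_sub_pow_add_log (a g c d σ : ℝ) (hx : σ + g ≠ 0) :
    HasDerivAt (fun σ : ℝ => (1 - (σ + g) ^ 12 * a) / (σ + g) ^ 6 + 12 * Real.log (σ + g) - c + d)
      (-6 / (σ + g) ^ 7 - 6 * a * (σ + g) ^ 5 + 12 / (σ + g)) σ := by
  have h : HasDerivAt (fun σ : ℝ => σ + g) 1 σ := (hasDerivAt_id σ).add_const g
  have hquot := (((h.pow 12).mul_const a).const_sub 1).div (h.pow 6) (pow_ne_zero 6 hx)
  refine (((hquot.add ((h.log hx).const_mul 12)).sub_const c).add_const d).congr_deriv ?_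
  simp only [Pi.pow_apply]
  field_simp
  push_cast
  ring

theorem hasDerivAt_inv_pow_sub_pow_add_inv (a g σ : ℝ) (hx : σ + g ≠ 0) :
    HasDerivAt (fun σ : ℝ => -6 / (σ + g) ^ 7 - 6 * a * (σ + g) ^ 5 + 12 / (σ + g))
      (42 / (σ + g) ^ 8 - 30 * a * (σ + g) ^ 4 - 12 / (σ + g) ^ 2) σ := by
  have h : HasDerivAt (fun σ : ℝ => σ + g) 1 σ := (hasDerivAt_id σ).add_const g
  have hinv7 := (hasDerivAt_const σ (-6 : ℝ)).div (h.pow 7) (pow_ne_zero 7 hx)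
  have hinv := (hasDerivAt_const σ (12 : ℝ)).div h hx
  refine ((hinv7.sub ((h.pow 5).const_mul (6 * a))).add hinv).congr_deriv ?_
  simp only [Pi.pow_apply]
  field_simp
  push_cast
  ring

/-- For fixed `0 < λ < 1`, with `g = λ⁻²(1 − √(1 − λ¹²))^{1/6}` and `s = √(1 − λ¹²)`,
the function `ψ(σ) = (1 − (σ+g)¹²λ¹²)/(σ+g)⁶ + 12·log(σ+g) − 2s + 2·log(1+s)`
satisfies `ψ(0) = 0`, `ψ′(0) = 0`, `ψ″(0) = 72 s/g² > 0`. -/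
theorem psi_derivs_at_zero (lam : ℝ) (h0 : 0 < lam) (h1 : lam < 1) :
    let s : ℝ := Real.sqrt (1 - lam ^ 12)
    let g : ℝ := lam⁻¹ ^ 2 * (1 - Real.sqrt (1 - lam ^ 12)) ^ ((1:ℝ)/6)
    let ψ : ℝ → ℝ := fun σ =>
      (1 - (σ + g) ^ 12 * lam ^ 12) / (σ + g) ^ 6 + 12 * Real.log (σ + g)
        - 2 * s + 2 * Real.log (1 + s)
    ψ 0 = 0 ∧ deriv ψ 0 = 0 ∧ iteratedDeriv 2 ψ 0 = 72 * s / g ^ 2 ∧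
      0 < 72 * s / g ^ 2 := by
  intro s g ψ
  have hl : lam ^ 12 < 1 := pow_lt_one₀ h0.le h1 (by norm_num)
  have hl0 : 0 < lam ^ 12 := by positivity
  have hs : 0 < s := Real.sqrt_pos.2 (by linarith)
  have hs2 : s ^ 2 = 1 - lam ^ 12 := Real.sq_sqrt (by linarith)
  have hs1 : 0 < 1 - s := by nlinarith
  have hg : 0 < g := mul_pos (by positivity) (Real.rpow_pos_of_pos hs1 _)
  have hr : ((1 - s) ^ ((1:ℝ)/6)) ^ 6 = 1 - s := by
    rw [← Real.rpow_natCast, ← Real.rpow_mul hs1.le]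
    norm_num
  have hgl : lam ^ 12 * g ^ 6 = 1 - s := by
    have : g ^ 6 = (lam⁻¹ ^ 2) ^ 6 * ((1 - s) ^ ((1:ℝ)/6)) ^ 6 := mul_pow _ _ _
    rw [this, hr]
    field_simp
  have hgs : (1 + s) * g ^ 6 = 1 := by
    refine mul_left_cancel₀ hs1.ne' ?_
    linear_combination hgl - g ^ 6 * hs2
  have hψ (σ : ℝ) (hσ : σ + g ≠ 0) := hasDerivAt_inv_pow_sub_pow_add_log (lam ^ 12) g (2 * s)
    (2 * Real.log (1 + s)) σ hσ
  have hg0 : (0 : ℝ) + g ≠ 0 := by simpa using hg.ne'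
  refine ⟨?_, ?_, ?_, by positivity⟩
  · have hlog : Real.log (1 + s) + 6 * Real.log g = 0 := by
      have := congrArg Real.log hgs
      rw [Real.log_mul (by positivity) (by positivity), Real.log_pow, Real.log_one] at this
      exact_mod_cast this
    have hfrac : (1 - g ^ 12 * lam ^ 12) / g ^ 6 = 2 * s := by
      rw [div_eq_iff (by positivity)]
      linear_combination (-g ^ 6) * hgl - hgs
    simp only [ψ, zero_add, hfrac]
    linear_combination 2 * hlog
  · rw [(hψ 0 hg0).deriv, zero_add]
    field_simp
    linear_combination (-6 * g ^ 6) * hgl + 6 * hgs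
  · have hev : deriv ψ =ᶠ[nhds 0] fun σ : ℝ =>
        -6 / (σ + g) ^ 7 - 6 * lam ^ 12 * (σ + g) ^ 5 + 12 / (σ + g) := by
      filter_upwards [(continuous_add_const g).continuousAt.eventually_ne hg0] with σ hσ
      exact (hψ σ hσ).deriv
    rw [iteratedDeriv_succ, iteratedDeriv_one, hev.deriv_eq,
      (hasDerivAt_inv_pow_sub_pow_add_inv _ g 0 hg0).deriv, zero_add]
    field_simp
    linear_combination (-30 * g ^ 6) * hgl - 42 * hgs
end
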